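/- Let G = PSL_2(q) for a prime power q ≥ 4. Then there exist three complex irreducible characters χ₁, χ₂, χ₃ of G, pairwise non-Aut-equivalent, such that S(Aut(G)) ≤ (χ₁(1)·χ₂(1)·χ₃(1))^{μ/3}, where μ = 3·log_{504}(168). -/

import Mathlib

open scoped MatrixGroups

/-- `b G`: the largest degree of a complex irreducible character of `G`. -/
noncomputable def maxIrrCharDegree (G : Type) [Group G] : ℕ :=
  sSup {d | ∃ V : FDRep ℂ G, CategoryTheory.Simple V ∧ Module.finrank ℂ V = d}

/-- `S G`: the largest order of a solvable subgroup of `G`. -/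
noncomputable def maxSolvableOrder (G : Type*) [Group G] : ℕ :=
  sSup {n | ∃ H : Subgroup G, IsSolvable H ∧ Nat.card H = n}

/-- Two irreducible representations of `G` are *Aut-equivalent* if their characters lie
in the same orbit of the natural action of `Aut G` on irreducible characters, i.e. one
character is the other precomposed with an automorphism of `G`. -/
def AutEquivalent {G : Type} [Group G] (V W : FDRep ℂ G) : Prop :=
  ∃ φ : G ≃* G, ∀ g : G, V.character (φ g) = W.character g

namespace PSLTwo

open Matrix

section Elements

variable {F : Type*} [Field F]

/-- The upper unipotent matrix with entry `b`. -/
def upper (b : F) : SL(2, F) := ⟨!![1, b; 0, 1], by simp⟩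

/-- The diagonal matrix with entries `a` and `a⁻¹`. -/
def diag (a : Fˣ) : SL(2, F) := ⟨!![(a : F), 0; 0, (a⁻¹ : Fˣ)], by simp⟩

/-- The antidiagonal matrix representing the nontrivial Weyl group element. -/
def weyl : SL(2, F) := ⟨!![0, 1; -1, 0], by simp⟩

/-- The projection from `SL₂` to `PSL₂`. -/
abbrev proj : SL(2, F) →* PSL(2, F) := QuotientGroup.mk' _

@[simp] lemma coe_upper (b : F) : (upper b : Matrix (Fin 2) (Fin 2) F) = !![1, b; 0, 1] := rfl

@[simp] lemma coe_diag (a : Fˣ) :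
    (diag a : Matrix (Fin 2) (Fin 2) F) = !![(a : F), 0; 0, (a : F)⁻¹] := by
  simp [diag]

@[simp] lemma coe_weyl : ((weyl : SL(2, F)) : Matrix (Fin 2) (Fin 2) F) = !![0, 1; -1, 0] := rfl

lemma sl_ext {x y : SL(2, F)} (h00 : x.1 0 0 = y.1 0 0) (h01 : x.1 0 1 = y.1 0 1)
    (h10 : x.1 1 0 = y.1 1 0) (h11 : x.1 1 1 = y.1 1 1) : x = y := by
  apply Subtype.ext
  ext i j
  fin_cases i <;> fin_cases j <;> assumption

lemma sl_det (x : SL(2, F)) : x.1 0 0 * x.1 1 1 - x.1 0 1 * x.1 1 0 = 1 := by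
  rw [← Matrix.det_fin_two]; exact x.2

lemma upper_add (b c : F) : upper (b + c) = upper b * upper c := by
  apply sl_ext <;> simp [add_comm]

@[simp] lemma upper_zero : upper (0 : F) = 1 := by
  apply sl_ext <;> simp

lemma upper_inv (b : F) : (upper b)⁻¹ = upper (-b) := by
  rw [inv_eq_iff_mul_eq_one, ← upper_add]; simp

lemma diag_mul (a b : Fˣ) : diag (a * b) = diag a * diag b := by
  apply sl_ext <;> simp [mul_comm]

lemma diag_mul_upper (a : Fˣ) (b : F) : diag a * upper b = upper (a ^ 2 * b) * diag a := by
  apply sl_ext <;> simp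
  field_simp

lemma diag_eq_word (a : Fˣ) :
    diag a = upper (a : F) * weyl * (upper ((a⁻¹ : Fˣ) : F) * weyl) * (upper (a : F) * weyl) := by
  apply sl_ext <;> simp

lemma weyl_inv : (weyl : SL(2, F))⁻¹ = -weyl := by
  rw [inv_eq_iff_mul_eq_one]
  apply sl_ext <;> simp

lemma eq_upper_mul_diag {x : SL(2, F)} (h : x.1 1 0 = 0) :
    ∃ (a : Fˣ) (b : F), x = upper b * diag a := by
  have hd := sl_det x
  rw [h] at hd
  have h0 : x.1 0 0 ≠ 0 := by rintro h0; simp [h0] at hd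
  have h1 : x.1 1 1 = (x.1 0 0)⁻¹ := by
    field_simp
    linear_combination hd
  refine ⟨Units.mk0 _ h0, x.1 0 1 * x.1 0 0, ?_⟩
  apply sl_ext <;> simp [h, h1]
  field_simp

lemma eq_upper_mul_weyl_mul {x : SL(2, F)} (h : x.1 1 0 ≠ 0) :
    ∃ (a : Fˣ) (b c : F), x = upper b * weyl * (upper c * diag a) := by
  have hd := sl_det x
  have key : (weyl⁻¹ * (upper (-(x.1 0 0 / x.1 1 0)) * x)).1 1 0 = 0 := by
    rw [weyl_inv]
    simp [Matrix.vecMul, dotProduct, h]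
  obtain ⟨a, c, hac⟩ := eq_upper_mul_diag key
  refine ⟨a, x.1 0 0 / x.1 1 0, c, ?_⟩
  rw [← hac, ← upper_inv]
  group

/-- `SL₂` is generated by the upper unipotent matrices and the Weyl element. -/
lemma subgroup_eq_top (H : Subgroup SL(2, F)) (hu : ∀ b, upper b ∈ H) (hw : weyl ∈ H) :
    H = ⊤ := by
  have ht : ∀ a, diag a ∈ H := fun a ↦ by
    rw [diag_eq_word]
    exact H.mul_mem (H.mul_mem (H.mul_mem (hu _) hw) (H.mul_mem (hu _) hw))
      (H.mul_mem (hu _) hw)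
  refine (Subgroup.eq_top_iff' H).2 fun x ↦ ?_
  by_cases h : x.1 1 0 = 0
  · obtain ⟨a, b, rfl⟩ := eq_upper_mul_diag h
    exact H.mul_mem (hu _) (ht _)
  · obtain ⟨a, b, c, rfl⟩ := eq_upper_mul_weyl_mul h
    exact H.mul_mem (H.mul_mem (hu _) hw) (H.mul_mem (hu _) (ht _))

lemma hom_ext {M : Type*} [Group M] {f g : SL(2, F) →* M} (hu : ∀ b, f (upper b) = g (upper b))
    (hw : f weyl = g weyl) : f = g := by
  have := subgroup_eq_top (f.eqLocus g) hu hw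
  ext x
  have hx : x ∈ f.eqLocus g := this ▸ Subgroup.mem_top x
  exact hx

lemma mem_center_iff' {x : SL(2, F)} :
    x ∈ Subgroup.center SL(2, F) ↔ x.1 0 1 = 0 ∧ x.1 1 0 = 0 ∧ x.1 0 0 = x.1 1 1 := by
  rw [Matrix.SpecialLinearGroup.mem_center_iff]
  constructor
  · rintro ⟨r, -, hr⟩
    rw [← hr]
    simp
  · rintro ⟨h1, h2, h3⟩
    refine ⟨x.1 1 1, ?_, ?_⟩
    · have := sl_det x
      rw [h1, h3] at this
      rw [Fintype.card_fin]; linear_combination this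
    · ext i j
      fin_cases i <;> fin_cases j <;> simp [h1, h2, h3]

lemma proj_eq_one_iff {x : SL(2, F)} :
    proj x = 1 ↔ x.1 0 1 = 0 ∧ x.1 1 0 = 0 ∧ x.1 0 0 = x.1 1 1 := by
  rw [← mem_center_iff']
  exact QuotientGroup.eq_one_iff x

lemma proj_eq_iff {x y : SL(2, F)} : proj x = proj y ↔ x = y ∨ x = -y := by
  constructor
  · intro h
    have h1 : proj (x * y⁻¹) = 1 := by rw [map_mul, map_inv, h, mul_inv_cancel]
    rw [proj_eq_one_iff] at h1
    obtain ⟨h01, h10, h00⟩ := h1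
    have hd := sl_det (x * y⁻¹)
    rw [h01, h00] at hd
    have h2 : ((x * y⁻¹).1 1 1 - 1) * ((x * y⁻¹).1 1 1 + 1) = 0 := by linear_combination hd
    rcases mul_eq_zero.1 h2 with h | h
    · left
      rw [← mul_inv_eq_one]
      have h' := sub_eq_zero.1 h
      apply sl_ext
      · rw [h00, h']; simp
      · rw [h01]; simp
      · rw [h10]; simp
      · rw [h']; simp
    · right
      have h' := eq_neg_of_add_eq_zero_left h
      have : x * y⁻¹ = -1 := by
        apply sl_ext
        · rw [h00, h']; simp
        · rw [h01]; simp
        · rw [h10]; simp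
        · rw [h']; simp
      rw [mul_inv_eq_iff_eq_mul] at this
      rw [this]; simp
  · rintro (rfl | rfl)
    · rfl
    · rw [← mul_inv_eq_one, ← map_inv, ← map_mul, proj_eq_one_iff]
      rw [neg_mul, mul_inv_cancel]
      simp

lemma proj_neg (x : SL(2, F)) : proj (-x) = proj x := proj_eq_iff.2 (Or.inr rfl)

lemma proj_upper_injective : Function.Injective fun b : F ↦ proj (upper b) := by
  intro b c h
  rcases proj_eq_iff.1 h with h | h
  · simpa using congrArg (fun x : SL(2, F) ↦ x.1 0 1) h
  · have h0 := congrArg (fun x : SL(2, F) ↦ x.1 0 0) h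
    have h1 := congrArg (fun x : SL(2, F) ↦ x.1 0 1) h
    simp at h0 h1
    linear_combination h1 - c * h0

end Elements

section Automorphisms

variable {F : Type*} [Field F]

/-- The conjugation action of `GL₂` on `SL₂`. -/
def glConj : GL (Fin 2) F →* MulAut SL(2, F) where
  toFun g :=
    { toFun x := ⟨g.1 * x.1 * g⁻¹.1, by
        rw [Matrix.det_mul_right_comm, ← Units.val_mul, mul_inv_cancel]; simp⟩
      invFun x := ⟨g⁻¹.1 * x.1 * g.1, by
        rw [Matrix.det_mul_right_comm, ← Units.val_mul, inv_mul_cancel]; simp⟩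
      left_inv x := Subtype.ext <| by
        change g⁻¹.1 * (g.1 * x.1 * g⁻¹.1) * g.1 = x.1
        simp only [← mul_assoc, ← Units.val_mul, inv_mul_cancel]
        simp only [mul_assoc, ← Units.val_mul, inv_mul_cancel]
        simp
      right_inv x := Subtype.ext <| by
        change g.1 * (g⁻¹.1 * x.1 * g.1) * g⁻¹.1 = x.1
        simp only [← mul_assoc, ← Units.val_mul, mul_inv_cancel]
        simp only [mul_assoc, ← Units.val_mul, mul_inv_cancel]
        simp
      map_mul' x y := Subtype.ext <| by
        change g.1 * (x.1 * y.1) * g⁻¹.1 = g.1 * x.1 * g⁻¹.1 * (g.1 * y.1 * g⁻¹.1)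
        have h : g⁻¹.1 * g.1 = 1 := by rw [← Units.val_mul, inv_mul_cancel]; rfl
        rw [show g.1 * x.1 * g⁻¹.1 * (g.1 * y.1 * g⁻¹.1) =
          g.1 * x.1 * (g⁻¹.1 * g.1) * y.1 * g⁻¹.1 by simp only [mul_assoc], h]
        simp only [mul_assoc, one_mul] }
  map_one' := by
    ext1 x
    apply Subtype.ext
    change (1 : GL (Fin 2) F).1 * x.1 * (1 : GL (Fin 2) F)⁻¹.1 = x.1
    simp
  map_mul' g h := by
    ext1 x
    apply Subtype.ext
    change (g * h).1 * x.1 * (g * h)⁻¹.1 = g.1 * (h.1 * x.1 * h⁻¹.1) * g⁻¹.1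
    rw [_root_.mul_inv_rev]
    simp only [Units.val_mul, mul_assoc]

lemma glConj_coe (g : GL (Fin 2) F) (x : SL(2, F)) :
    (glConj g x).1 = g.1 * x.1 * g⁻¹.1 := rfl

lemma glConj_toGL (s x : SL(2, F)) : glConj (SpecialLinearGroup.toGL s) x = s * x * s⁻¹ :=
  Subtype.ext <| by
    rw [glConj_coe, ← map_inv]
    rfl

/-- The automorphism of `PSL₂` induced by an automorphism of `SL₂`. -/
def autProj : MulAut SL(2, F) →* MulAut PSL(2, F) where
  toFun f := QuotientGroup.congr _ _ f <|
    Subgroup.characteristic_iff_map_eq.1 inferInstance f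
  map_one' := by
    ext1 x
    obtain ⟨x, rfl⟩ := QuotientGroup.mk_surjective x
    rfl
  map_mul' f g := by
    ext1 x
    obtain ⟨x, rfl⟩ := QuotientGroup.mk_surjective x
    rfl

lemma autProj_proj (f : MulAut SL(2, F)) (x : SL(2, F)) : autProj f (proj x) = proj (f x) := rfl

/-- The automorphism of `SL₂` induced by a field automorphism. -/
def fieldAut (σ : F ≃+* F) : MulAut SL(2, F) where
  toFun := SpecialLinearGroup.map σ.toRingHom
  invFun := SpecialLinearGroup.map σ.symm.toRingHom
  left_inv x := Subtype.ext <| by ext i j; simp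
  right_inv x := Subtype.ext <| by ext i j; simp
  map_mul' := map_mul _

lemma fieldAut_upper (σ : F ≃+* F) (b : F) : fieldAut σ (upper b) = upper (σ b) := by
  apply sl_ext <;> simp [fieldAut]

lemma fieldAut_diag (σ : F ≃+* F) (a : Fˣ) :
    fieldAut σ (diag a) = diag (Units.map σ.toMonoidHom a) := by
  apply sl_ext <;> simp [fieldAut]

lemma fieldAut_weyl (σ : F ≃+* F) : fieldAut σ weyl = weyl := by
  apply sl_ext <;> simp [fieldAut]

/-- The diagonal matrix with entries `δ` and `1`. -/
def diagGL (δ : Fˣ) : GL (Fin 2) F where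
  val := !![(δ : F), 0; 0, 1]
  inv := !![(δ : F)⁻¹, 0; 0, 1]
  val_inv := by ext i j; fin_cases i <;> fin_cases j <;> simp
  inv_val := by ext i j; fin_cases i <;> fin_cases j <;> simp

lemma glConj_diagGL (δ : Fˣ) (x : SL(2, F)) :
    (glConj (diagGL δ) x).1 = !![x.1 0 0, δ * x.1 0 1; (δ : F)⁻¹ * x.1 1 0, x.1 1 1] := by
  have h : (diagGL δ)⁻¹.1 = !![(δ : F)⁻¹, 0; 0, 1] := rfl
  rw [glConj_coe, h, eta_fin_two x.1]
  ext i j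
  fin_cases i <;> fin_cases j <;> simp [diagGL, mul_comm]

lemma glConj_diagGL_upper (δ : Fˣ) (b : F) :
    glConj (diagGL δ) (upper b) = upper (δ * b) := by
  apply sl_ext <;> simp [glConj_diagGL]

lemma glConj_diagGL_diag (δ a : Fˣ) : glConj (diagGL δ) (diag a) = diag a := by
  apply sl_ext <;> simp [glConj_diagGL]

/-- A `p`-subgroup of `PSL₂` in characteristic `p` is conjugate to a group of upper triangular
matrices. -/
lemma exists_conj_upperTriangular [Finite F] (p : ℕ) [Fact p.Prime] [CharP F p]
    (P : Subgroup PSL(2, F)) (hP : IsPGroup p P) :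
    ∃ s : SL(2, F), ∀ x : SL(2, F), proj x ∈ P → (s⁻¹ * x * s).1 1 0 = 0 := by
  have hp : p.Prime := Fact.out
  have hfin : Module.finrank F (Fin 2 → F) = 2 := by simp
  have hdvd : p ∣ Nat.card F := by
    have := Fintype.ofFinite F
    obtain ⟨n, -, hn⟩ := FiniteField.card F p
    rw [Nat.card_eq_fintype_card, hn]
    exact dvd_pow_self p n.pos.ne'
  have hcard : ¬ p ∣ Nat.card (Projectivization F (Fin 2 → F)) := by
    rw [Projectivization.card_of_finrank_two F _ hfin]
    intro h
    exact hp.one_lt.ne' (Nat.dvd_one.1 ((Nat.dvd_add_right hdvd).1 h))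
  obtain ⟨v, hv⟩ := hP.nonempty_fixed_point_of_prime_not_dvd_card _ hcard
  have he : (![1, 0] : Fin 2 → F) ≠ 0 := fun h ↦ by simpa using congrFun h 0
  obtain ⟨s, hs⟩ := MulAction.exists_smul_eq SL(2, F) (Projectivization.mk F ![1, 0] he) v
  refine ⟨s, fun x hx ↦ ?_⟩
  have h1 : x • v = v := hv ⟨proj x, hx⟩
  have h2 : (s⁻¹ * x * s) • (Projectivization.mk F ![1, 0] he) =
      Projectivization.mk F ![1, 0] he := by
    rw [mul_smul, mul_smul, hs, h1, inv_smul_eq_iff, hs]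
  rw [Projectivization.smul_mk, Projectivization.mk_eq_mk_iff] at h2
  obtain ⟨a, ha⟩ := h2
  have h3 := congrFun ha 1
  change (a • ![1, 0] : Fin 2 → F) 1 = ((s⁻¹ * x * s).1 *ᵥ ![1, 0]) 1 at h3
  simpa [Matrix.mulVec, dotProduct, Units.smul_def] using h3.symm

end Automorphisms

section Classification

variable {F : Type*} [Field F]

lemma pow_upperTriangular {x : SL(2, F)} (h : x.1 1 0 = 0) (n : ℕ) :
    (x ^ n).1 1 0 = 0 ∧ (x ^ n).1 0 0 = x.1 0 0 ^ n ∧ (x ^ n).1 1 1 = x.1 1 1 ^ n := by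
  induction n with
  | zero => simp
  | succ n ih =>
    obtain ⟨h1, h2, h3⟩ := ih
    rw [pow_succ]
    simp [Matrix.mul_apply, h, pow_succ]
    simp at h1 h2 h3
    simp [h1, h2, h3]

/-- An upper triangular element of order dividing the characteristic is unipotent modulo `±1`. -/
lemma exists_proj_eq_proj_upper (p : ℕ) [Fact p.Prime] [CharP F p] {x : SL(2, F)}
    (h : x.1 1 0 = 0) (hx : proj x ^ p = 1) : ∃ b, proj x = proj (upper b) := by
  obtain ⟨h1, h2, h3⟩ := pow_upperTriangular h p
  rw [← map_pow, proj_eq_one_iff, h2, h3] at hx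
  have hd := sl_det x
  rw [h, mul_zero, sub_zero] at hd
  have h4 : x.1 0 0 = x.1 1 1 := frobenius_inj F p hx.2.2
  rw [h4] at hd
  have h5 : (x.1 1 1 - 1) * (x.1 1 1 + 1) = 0 := by linear_combination hd
  rcases mul_eq_zero.1 h5 with h5 | h5
  · refine ⟨x.1 0 1, congrArg _ (sl_ext ?_ ?_ ?_ ?_)⟩
    · simpa [h4] using sub_eq_zero.1 h5
    · simp
    · simpa using h
    · simpa using sub_eq_zero.1 h5
  · refine ⟨-x.1 0 1, ?_⟩
    rw [← proj_neg]
    have h6 := eq_neg_of_add_eq_zero_left h5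
    refine congrArg _ (sl_ext ?_ ?_ ?_ ?_)
    · simp [h4, h6]
    · simp
    · simpa using h
    · simp [h6]

lemma upper_pow (b : F) (n : ℕ) : upper b ^ n = upper (n * b) := by
  induction n with
  | zero => simp
  | succ n ih => rw [pow_succ, ih, ← upper_add]; congr 1; push_cast; ring

lemma exists_conj_upper [Finite F] (p : ℕ) [Fact p.Prime] [CharP F p] (φ : MulAut PSL(2, F)) :
    ∃ s : SL(2, F), ∀ b, ∃ c,
      φ (proj (upper b)) = autProj (glConj (SpecialLinearGroup.toGL s)) (proj (upper c)) := by
  let u : Multiplicative F →* SL(2, F) :=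
    { toFun := fun b ↦ upper b.toAdd
      map_one' := upper_zero
      map_mul' := fun a b ↦ upper_add _ _ }
  have hpow : ∀ b : F, φ (proj (upper b)) ^ p = 1 := fun b ↦ by
    rw [← map_pow, ← map_pow, upper_pow]; simp
  let P := ((φ.toMonoidHom.comp proj).comp u).range
  have hP : IsPGroup p P := by
    rintro ⟨_, b, rfl⟩
    exact ⟨1, Subtype.ext (by rw [pow_one]; exact hpow b.toAdd)⟩
  obtain ⟨s, hs⟩ := exists_conj_upperTriangular p P hP
  refine ⟨s, fun b ↦ ?_⟩
  obtain ⟨x, hx⟩ := QuotientGroup.mk_surjective (φ (proj (upper b)))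
  have hx : proj x = φ (proj (upper b)) := hx
  have hxP : proj x ∈ P := ⟨Multiplicative.ofAdd b, hx.symm⟩
  obtain ⟨c, hc⟩ := exists_proj_eq_proj_upper p (hs x hxP) (by
    rw [map_mul, map_mul, map_inv]
    have := conj_pow (i := p) (a := (proj s)⁻¹) (b := proj x)
    rw [inv_inv] at this
    rw [this, hx, hpow]
    simp)
  refine ⟨c, ?_⟩
  rw [autProj_proj, glConj_toGL, map_mul, map_mul, ← hc, ← hx, ← map_mul, ← map_mul]
  congr 1
  group

lemma exists_normalized_upper_weyl [Finite F] (p : ℕ) [Fact p.Prime] [CharP F p]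
    (φ : MulAut PSL(2, F)) :
    ∃ (s : SL(2, F)) (c : F →+ F) (d : Fˣ) (x : SL(2, F)), Function.Bijective c ∧
      (∀ b, φ (proj (upper b)) =
        autProj (glConj (SpecialLinearGroup.toGL s)) (proj (upper (c b)))) ∧
      φ (proj weyl) = autProj (glConj (SpecialLinearGroup.toGL s)) (proj x) ∧
      x.1 = !![0, -((d⁻¹ : Fˣ) : F); (d : F), 0] := by
  obtain ⟨s, hs⟩ := exists_conj_upper p φ
  choose c hc using hs
  obtain ⟨ψ, hψ⟩ : ∃ ψ, ψ = (autProj (glConj (SpecialLinearGroup.toGL s)))⁻¹ * φ := ⟨_, rfl⟩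
  have hφ : φ = autProj (glConj (SpecialLinearGroup.toGL s)) * ψ := by rw [hψ, mul_inv_cancel_left]
  have hψu : ∀ b, ψ (proj (upper b)) = proj (upper (c b)) := fun b ↦ by
    rw [hψ, MulAut.mul_apply, hc, ← MulAut.mul_apply, inv_mul_cancel, MulAut.one_apply]
  let C : F →+ F := AddMonoidHom.mk' c fun a b ↦ proj_upper_injective <| by
    simp only [upper_add, map_mul, ← hψu]
  have hinj : Function.Injective c := fun a b h ↦ proj_upper_injective <|
    ψ.injective <| by simp only [hψu, h]
  have hbij : Function.Bijective c := Finite.injective_iff_bijective.1 hinj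
  obtain ⟨x, hx⟩ := QuotientGroup.mk_surjective (ψ (proj weyl))
  have hx : proj x = ψ (proj weyl) := hx
  have hx10 : x.1 1 0 ≠ 0 := by
    intro h
    obtain ⟨a, b, rfl⟩ := eq_upper_mul_diag h
    obtain ⟨d, hd⟩ := hbij.2 ((a : F) ^ 2 * c 1)
    have h1 : ψ (proj (weyl * upper 1 * weyl⁻¹)) = ψ (proj (upper d)) := by
      rw [hψu, hd, map_mul, map_mul, map_mul, map_mul, map_inv, map_inv, hψu, ← hx, ← map_mul,
        ← map_inv, ← map_mul, mul_assoc (upper b), diag_mul_upper]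
      congr 1
      rw [_root_.mul_inv_rev]
      calc _ = upper b * upper (a ^ 2 * c 1) * (upper b)⁻¹ := by group
        _ = _ := by rw [upper_inv, ← upper_add, ← upper_add]; congr 1; ring
    rcases proj_eq_iff.1 (ψ.injective h1) with h2 | h2
    · have := congrArg (fun x : SL(2, F) ↦ x.1 1 0) h2
      rw [weyl_inv] at this
      simp at this
    · have := congrArg (fun x : SL(2, F) ↦ x.1 1 0) h2
      rw [weyl_inv] at this
      simp at this
  set e := x.1 0 0 / x.1 1 0 with he
  set y := upper (-e) * x * upper e with hy
  have hyψ : ψ (proj weyl) = proj (upper e) * proj y * (proj (upper e))⁻¹ := by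
    rw [← hx, ← map_inv, ← map_mul, ← map_mul, hy, ← upper_inv]
    congr 1
    group
  have hy00 : y.1 0 0 = 0 := by
    simp [hy, Matrix.vecMul, dotProduct, Matrix.mul_apply, he]
    field_simp
    ring
  have hy10 : y.1 1 0 = x.1 1 0 := by
    simp [hy, Matrix.vecMul, dotProduct, Matrix.mul_apply]
  have hy11 : y.1 1 1 = 0 := by
    have hw2 : proj (weyl : SL(2, F)) ^ 2 = 1 := by
      rw [← map_pow, proj_eq_one_iff, pow_two]; simp
    have h2 : proj (y ^ 2) = 1 := by
      have := congrArg (fun z ↦ z ^ 2) hyψ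
      simp only [← map_pow ψ, hw2, conj_pow, map_one] at this
      rw [map_pow]
      simpa [eq_comm (a := (1 : PSL(2, F))), mul_inv_eq_one] using this
    have h3 := (proj_eq_one_iff.1 h2).2.1
    rw [pow_two] at h3
    simp [Matrix.mul_apply, hy00, hy10, hx10] at h3
    exact h3
  refine ⟨s * upper e, C, Units.mk0 _ hx10, y, hbij, fun b ↦ ?_, ?_, ?_⟩
  · rw [hφ, MulAut.mul_apply, hψu, map_mul, map_mul, map_mul, MulAut.mul_apply, autProj_proj _ (upper (C b)),
        glConj_toGL]
    congr 2
    rw [← upper_add, upper_inv, ← upper_add]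
    congr 1
    change c b = e + c b + -e
    ring
  · rw [hφ, MulAut.mul_apply, map_mul, map_mul, map_mul, MulAut.mul_apply, autProj_proj _ y,
      glConj_toGL, hyψ]
    simp only [map_mul, map_inv]
  · have hd := sl_det y
    rw [hy00, hy10] at hd
    rw [eta_fin_two y.1, hy00, hy10, hy11]
    have : y.1 0 1 = -(x.1 1 0)⁻¹ := by field_simp; linear_combination -hd
    simp [this]

end Classification

section Classification

variable {F : Type*} [Field F]

lemma word_entry (x y z : F) :
    (upper x * weyl * (upper y * weyl) * (upper z * weyl) : SL(2, F)).1 1 0 = 1 - y * z := by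
  simp; ring

/-- An automorphism of `PSL₂` that normalizes the unipotent elements and fixes the Weyl element
and one unipotent element comes from a field automorphism. -/
lemma exists_eq_autProj_fieldAut [Finite F] (p : ℕ) [Fact p.Prime] [CharP F p]
    (ψ : MulAut PSL(2, F)) (c : F →+ F) (hc : Function.Bijective c) (h1 : c 1 = 1)
    (hu : ∀ b, ψ (proj (upper b)) = proj (upper (c b))) (hw : ψ (proj weyl) = proj weyl) :
    ∃ σ : F ≃+* F, ψ = autProj (fieldAut σ) := by
  have hc0 : ∀ a : Fˣ, c a ≠ 0 := fun a h ↦ a.ne_zero (hc.1 (by rw [h, map_zero]))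
  have hdiag (a : Fˣ) : ψ (proj (diag a)) =
      proj (upper (c a) * weyl * (upper (c (a⁻¹ : Fˣ)) * weyl) * (upper (c a) * weyl)) := by
    rw [diag_eq_word]
    simp only [map_mul, hu, hw]
  have hinv (a : Fˣ) : c (a⁻¹ : Fˣ) * c a = 1 := by
    set x := upper (c a) * weyl * (upper (c (a⁻¹ : Fˣ)) * weyl) * (upper (c a) * weyl) with hx
    by_contra hne
    have hx10 : x.1 1 0 ≠ 0 := by
      rw [hx, word_entry]
      exact fun h ↦ hne (by linear_combination -h)
    have h2 : ψ (proj (diag a * upper 1)) = ψ (proj (upper ((a : F) ^ 2) * diag a)) := by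
      rw [diag_mul_upper, mul_one]
    rw [map_mul, map_mul, map_mul, map_mul, hu, hu, hdiag, ← hx, ← map_mul, ← map_mul, h1] at h2
    rcases proj_eq_iff.1 h2 with h3 | h3
    · have h00 := congrArg (fun x : SL(2, F) ↦ x.1 0 0) h3
      simp [Matrix.mul_apply] at h00
      have hca : c ((a : F) ^ 2) = 0 := by simpa [hx10] using h00
      exact hc0 (a ^ 2) (by simpa using hca)
    · have h10 := congrArg (fun x : SL(2, F) ↦ x.1 1 0) h3
      have h00 := congrArg (fun x : SL(2, F) ↦ x.1 0 0) h3
      simp [Matrix.mul_apply, Matrix.vecMul, dotProduct] at h00 h10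
      have h2 : (2 : F) = 0 := by
        have : 2 * x.1 1 0 = 0 := by linear_combination h10
        simpa [hx10] using this
      have hca : c ((a : F) ^ 2) = 0 := by
        have : c ((a : F) ^ 2) * x.1 1 0 = 0 := by linear_combination h00 - x.1 0 0 * h2
        simpa [hx10] using this
      exact hc0 (a ^ 2) (by simpa using hca)
  have hcinv (a : Fˣ) : c (a⁻¹ : Fˣ) = (c a)⁻¹ := eq_inv_of_mul_eq_one_left (hinv a)
  have hsq' (a : Fˣ) (b : F) : c (a ^ 2 * b) = c a ^ 2 * c b := by
    have h2 : ψ (proj (diag a * upper b)) = ψ (proj (upper (a ^ 2 * b) * diag a)) := by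
      rw [diag_mul_upper]
    have h3 := diag_eq_word (Units.mk0 _ (hc0 a))
    rw [Units.val_inv_eq_inv_val, Units.val_mk0, ← hcinv] at h3
    rw [map_mul, map_mul, map_mul, map_mul, hu, hu, hdiag, ← h3,
      ← map_mul, ← map_mul, diag_mul_upper, Units.val_mk0, map_mul, map_mul] at h2
    exact (proj_upper_injective (mul_right_cancel h2)).symm
  have hsq (a b : F) : c (a ^ 2 * b) = c a ^ 2 * c b := by
    rcases eq_or_ne a 0 with rfl | ha
    · simp
    · exact hsq' (Units.mk0 a ha) b
  have hmul (a b : F) : c (a * b) = c a * c b := by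
    by_cases h2 : (2 : F) = 0
    · have : CharP F 2 := CharTwo.of_one_ne_zero_of_two_eq_zero one_ne_zero h2
      have := Fintype.ofFinite F
      obtain ⟨r, rfl⟩ := (FiniteField.isSquare_of_char_two (ringChar.eq F 2) a)
      have := hsq r 1
      rw [h1, mul_one, mul_one] at this
      rw [← pow_two, hsq, this]
    · have h3 := hsq (a + 1) b
      have h4 := hsq a b
      rw [show (a + 1) ^ 2 * b = a ^ 2 * b + (a * b + a * b) + b by ring] at h3
      simp only [map_add, h1] at h3
      apply mul_left_cancel₀ h2
      linear_combination h3 - h4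
  let σ : F →+* F :=
    { c with
      map_one' := h1
      map_mul' := hmul }
  refine ⟨RingEquiv.ofBijective σ hc, ?_⟩
  have : ψ.toMonoidHom.comp proj =
      (autProj (fieldAut (RingEquiv.ofBijective σ hc))).toMonoidHom.comp proj := by
    apply hom_ext
    · intro b
      change ψ (proj (upper b)) = proj (fieldAut _ (upper b))
      rw [hu, fieldAut_upper]
      rfl
    · change ψ (proj weyl) = proj (fieldAut _ weyl)
      rw [hw, fieldAut_weyl]
  ext1 y
  obtain ⟨x, rfl⟩ := QuotientGroup.mk_surjective y
  exact DFunLike.congr_fun this x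

/-- Every automorphism of `PSL₂` over a finite field is semilinear. -/
theorem exists_eq_conj_mul_fieldAut [Finite F] (p : ℕ) [Fact p.Prime] [CharP F p]
    (φ : MulAut PSL(2, F)) :
    ∃ (s : SL(2, F)) (δ : Fˣ) (σ : F ≃+* F),
      φ = autProj (glConj (SpecialLinearGroup.toGL s * diagGL δ)) * autProj (fieldAut σ) := by
  obtain ⟨s, c, d, x, hc, hu, hw, hx⟩ := exists_normalized_upper_weyl p φ
  have hδ : c 1 ≠ 0 := fun h ↦ one_ne_zero (hc.1 (by rw [h, map_zero]))
  set δ := Units.mk0 _ hδ with hδdef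
  set g := SpecialLinearGroup.toGL s * diagGL δ with hg
  have hgu (b : F) : φ (proj (upper b)) = autProj (glConj g) (proj (upper (c b / c 1))) := by
    rw [hu, hg, map_mul, map_mul, MulAut.mul_apply, autProj_proj (glConj (diagGL δ)),
      glConj_diagGL_upper]
    congr 3
    rw [hδdef, Units.val_mk0]; field_simp
  obtain ⟨y, hy⟩ : ∃ y, glConj (diagGL δ) y = x := (glConj (diagGL δ)).surjective x
  have hgw : φ (proj weyl) = autProj (glConj g) (proj y) := by
    rw [hw, hg, map_mul, map_mul, MulAut.mul_apply, autProj_proj (glConj (diagGL δ)), hy]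
  have hy' := glConj_diagGL δ y
  rw [hy, hx] at hy'
  have e00 := congrFun₂ hy' 0 0
  have e01 := congrFun₂ hy' 0 1
  have e10 := congrFun₂ hy' 1 0
  have e11 := congrFun₂ hy' 1 1
  simp [hδdef] at e00 e01 e10 e11
  set e : F := d * c 1 with he
  have e0 : e ≠ 0 := mul_ne_zero d.ne_zero hδ
  have y10 : y.1 1 0 = e := by rw [he, e10]; field_simp
  have y01 : y.1 0 1 = -e⁻¹ := by
    have : -((d : F)⁻¹) / c 1 = y.1 0 1 := by rw [e01]; field_simp
    rw [← this, he]
    field_simp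
  have hcube : proj ((y * upper 1) ^ 3) = 1 := by
    have h3 : ((weyl : SL(2, F)) * upper 1) ^ 3 = 1 := by
      apply sl_ext <;> simp [pow_succ]
    have h4 : φ (proj ((weyl * upper 1) ^ 3)) = autProj (glConj g) (proj ((y * upper 1) ^ 3)) := by
      simp only [map_pow, map_mul, hgw, hgu, div_self hδ]
    rw [h3, map_one, map_one] at h4
    exact (autProj (glConj g)).injective (by rw [← h4, map_one])
  have he2 : (e - 1) * (e + 1) = 0 := by
    have := (proj_eq_one_iff.1 hcube).2.1
    simp [pow_succ, Matrix.mul_apply, ← e00, ← e11, y10, y01] at this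
    field_simp at this
    rcases this with h | h
    · linear_combination h
    · exact absurd h e0
  have hyw : proj y = proj weyl := by
    rw [proj_eq_iff]
    rcases mul_eq_zero.1 he2 with h | h
    · right
      have h := sub_eq_zero.1 h
      apply sl_ext <;> simp [← e00, ← e11, y10, y01, h]
    · left
      have h := eq_neg_of_add_eq_zero_left h
      apply sl_ext <;> simp [← e00, ← e11, y10, y01, h]
  let C : F →+ F := (AddMonoidHom.mulRight (c 1)⁻¹).comp c
  have hC : ∀ b, C b = c b / c 1 := fun b ↦ (div_eq_mul_inv _ _).symm
  have hCinj : Function.Injective C := fun a b h ↦ hc.1 <| by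
    rw [hC, hC] at h
    field_simp at h
    exact h
  obtain ⟨σ, hσ⟩ := exists_eq_autProj_fieldAut p ((autProj (glConj g))⁻¹ * φ) C
    (Finite.injective_iff_bijective.1 hCinj) (by rw [hC, div_self hδ])
    (fun b ↦ by
      rw [MulAut.mul_apply, hgu, ← MulAut.mul_apply, inv_mul_cancel, hC, MulAut.one_apply])
    (by rw [MulAut.mul_apply, hgw, ← MulAut.mul_apply, inv_mul_cancel, hyw, MulAut.one_apply])
  exact ⟨s, δ, σ, by rw [← hσ, mul_inv_cancel_left]⟩

end Classification

section SolvableLinear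

variable {F : Type*} [Field F]

lemma exists_eq_of_commute {x z : Matrix (Fin 2) (Fin 2) F} (hx : ∀ c : F, x ≠ c • 1)
    (h : z * x = x * z) : ∃ a b : F, z = a • 1 + b • x := by
  have h00 := congrFun₂ h 0 0
  have h01 := congrFun₂ h 0 1
  have h10 := congrFun₂ h 1 0
  simp only [Matrix.mul_apply, Fin.sum_univ_two] at h00 h01 h10
  by_cases h1 : x 0 1 = 0
  · by_cases h2 : x 1 0 = 0
    · have h3 : x 0 0 - x 1 1 ≠ 0 := fun h3 ↦ hx (x 0 0) <| by
        ext i j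
        fin_cases i <;> fin_cases j <;> simp [h1, h2]
        linear_combination -h3
      have h4 : z 0 1 = 0 := by
        have : (x 0 0 - x 1 1) * z 0 1 = 0 := by linear_combination -h01 + (z 0 0 - z 1 1) * h1
        simpa [h3] using this
      have h5 : z 1 0 = 0 := by
        have : (x 0 0 - x 1 1) * z 1 0 = 0 := by linear_combination h10 - (z 1 1 - z 0 0) * h2
        simpa [h3] using this
      refine ⟨z 0 0 - (z 0 0 - z 1 1) / (x 0 0 - x 1 1) * x 0 0,
        (z 0 0 - z 1 1) / (x 0 0 - x 1 1), ?_⟩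
      ext i j
      fin_cases i <;> fin_cases j <;> simp [h1, h2, h4, h5]
      field_simp
      ring
    · refine ⟨z 0 0 - z 1 0 / x 1 0 * x 0 0, z 1 0 / x 1 0, ?_⟩
      ext i j
      fin_cases i <;> fin_cases j <;> simp
      · field_simp
        linear_combination h00
      · field_simp
      · field_simp
        linear_combination h10
  · refine ⟨z 0 0 - z 0 1 / x 0 1 * x 0 0, z 0 1 / x 0 1, ?_⟩
    ext i j
    fin_cases i <;> fin_cases j <;> simp
    · field_simp
    · field_simp
      linear_combination -h00
    · field_simp
      linear_combination -h01

lemma card_le_mul_of_fibers {α β : Type*} [Finite α] [DecidableEq β] (f : α → β) (S : Finset β)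
    (n : ℕ) (hS : ∀ y, f y ∈ S) (hn : ∀ y₀, Nat.card {y // f y = f y₀} ≤ n) :
    Nat.card α ≤ S.card * n := by
  classical
  have := Fintype.ofFinite α
  rw [Nat.card_eq_fintype_card, ← Finset.card_univ, mul_comm]
  refine Finset.card_le_mul_card_image_of_maps_to (f := f) (fun y _ ↦ hS y) n fun b _ ↦ ?_
  by_cases hb : ∃ y₀, f y₀ = b
  · obtain ⟨y₀, rfl⟩ := hb
    have := hn y₀
    rwa [Nat.card_eq_fintype_card, Fintype.card_subtype] at this
  · push Not at hb
    simp [hb]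

lemma commute_of_conj_eq {x : Matrix (Fin 2) (Fin 2) F} {y y₀ : GL (Fin 2) F}
    (h : y.1 * x * y⁻¹.1 = y₀.1 * x * y₀⁻¹.1) : (y₀⁻¹ * y).1 * x = x * (y₀⁻¹ * y).1 := by
  have hy : y⁻¹.1 * y.1 = 1 := by rw [← Units.val_mul, inv_mul_cancel]; rfl
  have hy₀ : y₀⁻¹.1 * y₀.1 = 1 := by rw [← Units.val_mul, inv_mul_cancel]; rfl
  calc (y₀⁻¹ * y).1 * x = y₀⁻¹.1 * (y.1 * x * y⁻¹.1) * y.1 := by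
        simp only [mul_assoc, hy, Units.val_mul, mul_one]
    _ = (y₀⁻¹.1 * y₀.1) * x * y₀⁻¹.1 * y.1 := by rw [h]; simp only [mul_assoc]
    _ = _ := by rw [hy₀, one_mul, mul_assoc, Units.val_mul]

lemma card_le_of_maps_to [Finite F] {β : Type*} [DecidableEq β] (L : Subgroup (GL (Fin 2) F))
    (f : GL (Fin 2) F → β) (S : Finset β) (T : Finset (Matrix (Fin 2) (Fin 2) F))
    (hS : ∀ y ∈ L, f y ∈ S)
    (hT : ∀ y y₀ : GL (Fin 2) F, f y = f y₀ → (y₀⁻¹ * y).1 ∈ T) :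
    Nat.card L ≤ S.card * T.card := by
  have : Finite (Matrix (Fin 2) (Fin 2) F) := inferInstanceAs (Finite (Fin 2 → Fin 2 → F))
  refine card_le_mul_of_fibers (fun y : L ↦ f y) S _ (fun y ↦ hS y y.2) fun y₀ ↦ ?_
  have hcard : Nat.card T = T.card := by simp
  rw [← hcard]
  refine Nat.card_le_card_of_injective
    (fun y ↦ ⟨(y₀.1⁻¹ * y.1.1).1, hT _ _ y.2⟩) fun a b hab ↦ ?_
  exact Subtype.ext (Subtype.ext (mul_left_cancel (Units.ext (Subtype.ext_iff.1 hab))))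

lemma conj_trace_det (y : GL (Fin 2) F) (x : Matrix (Fin 2) (Fin 2) F) :
    (y.1 * x * y⁻¹.1).trace = x.trace ∧ (y.1 * x * y⁻¹.1).det = x.det := by
  constructor
  · rw [Matrix.trace_mul_comm, ← mul_assoc, ← Units.val_mul, inv_mul_cancel, Units.val_one, one_mul]
  · rw [Matrix.det_mul_right_comm, ← Units.val_mul, mul_inv_cancel, Units.val_one, one_mul]

lemma conj_nonscalar (y : GL (Fin 2) F) {x : Matrix (Fin 2) (Fin 2) F}
    (hx : ∀ c : F, x ≠ c • 1) (c : F) : y.1 * x * y⁻¹.1 ≠ c • 1 := by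
  intro h
  apply hx c
  calc x = y⁻¹.1 * (y.1 * x * y⁻¹.1) * y.1 := by
        have hy : y⁻¹.1 * y.1 = 1 := by rw [← Units.val_mul, inv_mul_cancel]; rfl
        simp only [mul_assoc, hy, mul_one]
        rw [← mul_assoc, hy, one_mul]
    _ = _ := by
      rw [h, mul_smul_comm, mul_one, smul_mul_assoc, ← Units.val_mul, inv_mul_cancel, Units.val_one]

/-- A group of matrices normalizing the algebra generated by a nonscalar matrix is small. -/
lemma card_le_of_conj_commute [Finite F] (hq : 4 ≤ Nat.card F) (L : Subgroup (GL (Fin 2) F))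
    (x : Matrix (Fin 2) (Fin 2) F) (hx : ∀ c : F, x ≠ c • 1)
    (hL : ∀ y ∈ L, y.1 * x * y⁻¹.1 * x = x * (y.1 * x * y⁻¹.1)) :
    Nat.card L ≤ (Nat.card F - 1) * (Nat.card F * (Nat.card F - 1)) := by
  classical
  have := Fintype.ofFinite F
  set q := Nat.card F with hqdef
  have hqF : Fintype.card F = q := by rw [hqdef, Nat.card_eq_fintype_card]
  have hform (y) (hy : y ∈ L) : ∃ a b : F, y.1 * x * y⁻¹.1 = a • 1 + b • x ∧ b ≠ 0 ∧
      2 * a = (1 - b) * x.trace ∧ a ^ 2 + a * b * x.trace + b ^ 2 * x.det = x.det := by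
    obtain ⟨a, b, hab⟩ := exists_eq_of_commute hx (hL y hy)
    obtain ⟨ht, hd⟩ := conj_trace_det y x
    refine ⟨a, b, hab, ?_, ?_, ?_⟩
    · rintro rfl
      exact conj_nonscalar y hx a (by rw [hab]; simp)
    · rw [hab] at ht
      simp [Matrix.trace_fin_two] at ht ⊢
      linear_combination ht
    · rw [hab] at hd
      simp [Matrix.det_fin_two, Matrix.trace_fin_two] at hd ⊢
      linear_combination hd
  by_cases hdisc : ∃ r : F, 2 * r = x.trace ∧ r ^ 2 = x.det
  · obtain ⟨r, hrt, hrd⟩ := hdisc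
    have hdet0 : (x - r • (1 : Matrix (Fin 2) (Fin 2) F)).det = 0 := by
      simp [Matrix.det_fin_two, Matrix.trace_fin_two] at hrt hrd ⊢
      linear_combination -hrd + r * hrt
    refine (card_le_of_maps_to L (fun y ↦ y.1 * x * y⁻¹.1)
      ((Finset.univ.erase (0 : F)).image fun b ↦ ((1 - b) * r) • 1 + b • x)
      (((Finset.univ : Finset F) ×ˢ (Finset.univ.erase (0 : F))).image
        fun ab ↦ (ab.2 - ab.1 * r) • 1 + ab.1 • x) ?_ ?_).trans ?_
    · intro y hy
      obtain ⟨a, b, h, hb, h1, h2⟩ := hform y hy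
      refine Finset.mem_image.2 ⟨b, by simp [hb], ?_⟩
      rw [h]
      congr 2
      have : (a - (1 - b) * r) ^ 2 = 0 := by
        rw [← hrt] at h1 h2
        rw [← hrd] at h2
        linear_combination h2 - r * h1
      linear_combination -(pow_eq_zero_iff two_ne_zero).1 this
    · intro y y₀ h
      obtain ⟨a, b, hab⟩ := exists_eq_of_commute hx (commute_of_conj_eq h)
      refine Finset.mem_image.2 ⟨(b, a + b * r), ?_, ?_⟩
      · simp only [Finset.mem_product, Finset.mem_univ, Finset.mem_erase, true_and, and_true]
        intro h0
        have h1 : (y₀⁻¹ * y).1 = b • (x - r • 1) := by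
          rw [hab, eq_neg_of_add_eq_zero_left h0]
          module
        have h2 : (y₀⁻¹ * y).1.det = 0 := by rw [h1, Matrix.det_smul, hdet0, mul_zero]
        exact (Matrix.isUnits_det_units (y₀⁻¹ * y)).ne_zero h2
      · dsimp only
        rw [hab]; congr 2; ring
    · refine (Nat.mul_le_mul Finset.card_image_le Finset.card_image_le).trans ?_
      simp [hqF]
  · obtain ⟨S, hScard, hS⟩ : ∃ S : Finset (F × F), S.card ≤ 2 ∧ ∀ a b : F, b ≠ 0 →
        2 * a = (1 - b) * x.trace → a ^ 2 + a * b * x.trace + b ^ 2 * x.det = x.det →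
        (a, b) ∈ S := by
      by_cases h2 : (2 : F) = 0
      · have : CharP F 2 := CharTwo.of_one_ne_zero_of_two_eq_zero one_ne_zero h2
        have ht : x.trace ≠ 0 := by
          intro ht
          obtain ⟨r, hr⟩ := FiniteField.isSquare_of_char_two (ringChar.eq F 2) x.det
          exact hdisc ⟨r, by rw [h2, ht, zero_mul], by rw [hr, pow_two]⟩
        refine ⟨{(0, 1), (x.trace, 1)}, Finset.card_le_two, fun a b hb h1 hd ↦ ?_⟩
        have hb1 : b = 1 := by
          rw [h2, zero_mul, eq_comm, mul_eq_zero, or_iff_left ht] at h1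
          linear_combination -h1
        subst hb1
        have : a * (a + x.trace) = 0 := by linear_combination hd
        rcases mul_eq_zero.1 this with h | h
        · simp [h]
        · have : a = x.trace := by linear_combination h - x.trace * h2
          simp [this]
      · have hd : x.trace ^ 2 - 4 * x.det ≠ 0 := by
          intro h
          refine hdisc ⟨x.trace / 2, by field_simp, ?_⟩
          have h4 : (4 : F) ≠ 0 := by
            rw [show (4 : F) = 2 * 2 by norm_num]; exact mul_ne_zero h2 h2
          field_simp
          linear_combination h
        refine ⟨{(0, 1), (x.trace, -1)}, Finset.card_le_two, fun a b hb h1 hd' ↦ ?_⟩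
        have : (1 - b) * (1 + b) = 0 := by
          have : (x.trace ^ 2 - 4 * x.det) * ((1 - b) * (1 + b)) = 0 := by
            linear_combination 4 * hd' - (2 * a + (1 - b) * x.trace + 2 * b * x.trace) * h1
          simpa [hd] using this
        rcases mul_eq_zero.1 this with h | h
        · have hb1 : b = 1 := by linear_combination -h
          subst hb1
          have : a = 0 := by simpa [h2] using h1
          simp [this]
        · have hb1 : b = -1 := by linear_combination h
          subst hb1
          have : a = x.trace := mul_left_cancel₀ h2 (by linear_combination h1)
          simp [this]
    refine (card_le_of_maps_to L (fun y ↦ y.1 * x * y⁻¹.1)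
      (S.image fun ab ↦ ab.1 • 1 + ab.2 • x)
      (((Finset.univ : Finset (F × F)).erase 0).image fun ab ↦ ab.1 • 1 + ab.2 • x) ?_ ?_).trans ?_
    · intro y hy
      obtain ⟨a, b, h, hb, h1, h2⟩ := hform y hy
      exact Finset.mem_image.2 ⟨(a, b), hS a b hb h1 h2, h.symm⟩
    · intro y y₀ h
      obtain ⟨a, b, hab⟩ := exists_eq_of_commute hx (commute_of_conj_eq h)
      refine Finset.mem_image.2 ⟨(a, b), ?_, hab.symm⟩
      simp only [Finset.mem_erase, Finset.mem_univ, and_true]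
      intro h0
      obtain ⟨rfl, rfl⟩ := Prod.mk_eq_zero.1 h0
      have : (y₀⁻¹ * y).1.det = 0 := by rw [hab]; simp
      exact (Matrix.isUnits_det_units (y₀⁻¹ * y)).ne_zero this
    · refine (Nat.mul_le_mul (Finset.card_image_le.trans hScard) Finset.card_image_le).trans ?_
      rw [Finset.card_erase_of_mem (Finset.mem_univ _), Finset.card_univ, Fintype.card_prod, hqF]
      obtain ⟨k, hk⟩ := Nat.exists_eq_add_of_le hq
      rw [hk]
      have e1 : 4 + k - 1 = k + 3 := by omega
      have e2 : (4 + k) * (4 + k) - 1 = (k + 3) * (k + 5) := by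
        rw [show (4 + k) * (4 + k) = (k + 3) * (k + 5) + 1 by ring]; rfl
      rw [e1, e2]
      nlinarith [Nat.zero_le (k ^ 2), Nat.zero_le (k ^ 3)]

end SolvableLinear

section SolvableLinear

variable {F : Type*} [Field F]

lemma exists_eq_smul_one_of_commute {x y z : Matrix (Fin 2) (Fin 2) F} (hxy : x * y ≠ y * x)
    (hzx : z * x = x * z) (hzy : z * y = y * z) : ∃ c : F, z = c • 1 := by
  have hx : ∀ c : F, x ≠ c • 1 := by rintro c rfl; simp at hxy
  obtain ⟨a, b, rfl⟩ := exists_eq_of_commute hx hzx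
  refine ⟨a, ?_⟩
  have hb : b = 0 := by
    by_contra hb
    apply hxy
    simpa [add_mul, mul_add, hb] using hzy
  simp [hb]

/-- A matrix commuting or anticommuting with each of two anticommuting invertible matrices. -/
lemma exists_eq_smul_of_anticommute {x y z : Matrix (Fin 2) (Fin 2) F} (hxy : x * y ≠ y * x)
    (hanti : x * y = -(y * x)) (hxd : x.det ≠ 0) (hyd : y.det ≠ 0)
    (hzx : z * x = x * z ∨ z * x = -(x * z)) (hzy : z * y = y * z ∨ z * y = -(y * z)) :
    ∃ c : F, z = c • 1 ∨ z = c • x ∨ z = c • y ∨ z = c • (x * y) := by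
  have hanti' : y * x = -(x * y) := by rw [hanti, neg_neg]
  have hsq (w : Matrix (Fin 2) (Fin 2) F) (hw : w.det ≠ 0) (hwx : w * x = x * w ∨ w * x = -(x * w))
      (hwy : w * y = y * w ∨ w * y = -(y * w)) : ∃ d : F, d ≠ 0 ∧ w * w = d • 1 := by
    obtain ⟨d, hd⟩ := exists_eq_smul_one_of_commute (z := w * w) hxy
      (by rcases hwx with h | h <;> simp [mul_assoc, h] <;> simp [← mul_assoc, h])
      (by rcases hwy with h | h <;> simp [mul_assoc, h] <;> simp [← mul_assoc, h])
    refine ⟨d, ?_, hd⟩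
    rintro rfl
    have := congrArg Matrix.det hd
    simp [hw] at this
  have key (w : Matrix (Fin 2) (Fin 2) F) (hw : w.det ≠ 0)
      (hwx : w * x = x * w ∨ w * x = -(x * w)) (hwy : w * y = y * w ∨ w * y = -(y * w))
      (h1 : z * w * x = x * (z * w)) (h2 : z * w * y = y * (z * w)) : ∃ c : F, z = c • w := by
    obtain ⟨d, hd0, hd⟩ := hsq w hw hwx hwy
    obtain ⟨c, hc⟩ := exists_eq_smul_one_of_commute (z := z * w) hxy h1 h2
    refine ⟨d⁻¹ * c, ?_⟩
    have : z * w * w = c • w := by rw [hc]; simp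
    rw [mul_assoc, hd] at this
    rw [mul_smul, ← this]
    simp [hd0]
  rcases hzx with h1 | h1 <;> rcases hzy with h2 | h2
  · obtain ⟨c, hc⟩ := exists_eq_smul_one_of_commute hxy h1 h2
    exact ⟨c, Or.inl hc⟩
  · obtain ⟨c, hc⟩ := key x hxd (Or.inl rfl) (Or.inr hanti)
      (by rw [h1, mul_assoc, h1]) (by rw [mul_assoc, hanti, mul_neg, ← mul_assoc, h2]; simp [mul_assoc])
    exact ⟨c, Or.inr (Or.inl hc)⟩
  · obtain ⟨c, hc⟩ := key y hyd (Or.inr hanti') (Or.inl rfl)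
      (by rw [mul_assoc, hanti', mul_neg, ← mul_assoc, h1]; simp [mul_assoc])
      (by rw [h2, mul_assoc, h2])
    exact ⟨c, Or.inr (Or.inr (Or.inl hc))⟩
  · obtain ⟨c, hc⟩ := key (x * y) (by simp [hxd, hyd])
      (Or.inr (by rw [mul_assoc, hanti', mul_neg]))
      (Or.inr (by rw [← mul_assoc, hanti', neg_mul, neg_neg]))
      (by
        calc z * (x * y) * x = z * x * (y * x) := by simp only [mul_assoc]
          _ = x * (z * (x * y)) := by rw [h1, hanti']; simp [mul_assoc])
      (by
        calc z * (x * y) * y = -(z * y * (x * y)) := by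
              conv_lhs => rw [hanti, mul_neg, neg_mul]
              simp only [mul_assoc]
          _ = _ := by rw [h2]; simp [mul_assoc])
    exact ⟨c, Or.inr (Or.inr (Or.inr hc))⟩

lemma exists_card_le_two [Finite F] (w t : Matrix (Fin 2) (Fin 2) F) (hw : w.det ≠ 0) :
    ∃ S : Finset (Matrix (Fin 2) (Fin 2) F), S.card ≤ 2 ∧
      ∀ c : F, (c • w).det = t.det → c • w ∈ S := by
  classical
  by_cases h : ∃ r : F, (r • w).det = t.det
  · obtain ⟨r, hr⟩ := h
    refine ⟨{r • w, (-r) • w}, Finset.card_le_two, fun c hc ↦ ?_⟩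
    have : (c - r) * (c + r) = 0 := by
      rw [← hr, Matrix.det_smul, Matrix.det_smul, Fintype.card_fin] at hc
      have := mul_right_cancel₀ hw hc
      linear_combination this
    rcases mul_eq_zero.1 this with h | h
    · simp [sub_eq_zero.1 h]
    · rw [eq_neg_of_add_eq_zero_left h]; simp
  · exact ⟨∅, by simp, fun c hc ↦ absurd ⟨c, hc⟩ h⟩

/-- A group of matrices normalizing a quaternion-type configuration is small. -/
lemma card_le_of_conj_anticommute [Finite F] (L : Subgroup (GL (Fin 2) F))
    (x y : GL (Fin 2) F) (hxy : x.1 * y.1 ≠ y.1 * x.1) (hanti : x.1 * y.1 = -(y.1 * x.1))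
    (hx : ∀ g ∈ L, ∀ w ∈ ({x, y} : Set (GL (Fin 2) F)), ∀ v ∈ ({x, y} : Set (GL (Fin 2) F)),
      (g.1 * w.1 * g⁻¹.1) * v.1 = v.1 * (g.1 * w.1 * g⁻¹.1) ∨
      (g.1 * w.1 * g⁻¹.1) * v.1 = -(v.1 * (g.1 * w.1 * g⁻¹.1))) :
    Nat.card L ≤ 24 * (Nat.card F - 1) := by
  classical
  have := Fintype.ofFinite F
  have hd (g : GL (Fin 2) F) : g.1.det ≠ 0 := (Matrix.isUnits_det_units g).ne_zero
  have hns {w v : GL (Fin 2) F} (h : w.1 * v.1 ≠ v.1 * w.1) (c : F) : w.1 ≠ c • 1 := by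
    intro hc
    rw [hc] at h
    simp at h
  let W : Fin 3 → Matrix (Fin 2) (Fin 2) F := ![x.1, y.1, x.1 * y.1]
  have hWd : ∀ i, (W i).det ≠ 0 := by
    intro i
    fin_cases i <;> simp [W, hd]
  have hmem (g) (hg : g ∈ L) (w) (hw : w ∈ ({x, y} : Set (GL (Fin 2) F))) :
      ∃ (i : Fin 3) (c : F), g.1 * w.1 * g⁻¹.1 = c • W i := by
    have hwns : ∀ c : F, w.1 ≠ c • 1 := by
      rcases hw with rfl | rfl
      · exact hns hxy
      · exact hns hxy.symm
    obtain ⟨c, h | h | h | h⟩ := exists_eq_smul_of_anticommute hxy hanti (hd x) (hd y)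
      (hx g hg w hw x (by simp)) (hx g hg w hw y (by simp))
    · exact absurd h (conj_nonscalar g hwns c)
    · exact ⟨0, c, h⟩
    · exact ⟨1, c, h⟩
    · exact ⟨2, c, h⟩
  choose R hRcard hR using fun (i : Fin 3) (t : Matrix (Fin 2) (Fin 2) F) ↦
    exists_card_le_two (W i) t (hWd i)
  have hne (g) (hg : g ∈ L) (i : Fin 3) (c d : F) (h1 : g.1 * x.1 * g⁻¹.1 = c • W i)
      (h2 : g.1 * y.1 * g⁻¹.1 = d • W i) : False := by
    apply hxy
    have hgg : g⁻¹.1 * g.1 = 1 := by rw [← Units.val_mul, inv_mul_cancel]; rfl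
    have e (a b : Matrix (Fin 2) (Fin 2) F) :
        a * b = g⁻¹.1 * ((g.1 * a * g⁻¹.1) * (g.1 * b * g⁻¹.1)) * g.1 := by
      calc a * b = (g⁻¹.1 * g.1) * a * (g⁻¹.1 * g.1) * b * (g⁻¹.1 * g.1) := by
            simp only [hgg, one_mul, mul_one]
        _ = _ := by simp only [mul_assoc]
    rw [e, e y.1, h1, h2]
    simp only [smul_mul_smul_comm, mul_comm c d]
  refine (card_le_of_maps_to L (fun g ↦ (g.1 * x.1 * g⁻¹.1, g.1 * y.1 * g⁻¹.1))
    ((Finset.univ : Finset (Fin 3)).offDiag.biUnion fun ij ↦ R ij.1 x.1 ×ˢ R ij.2 y.1)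
    ((Finset.univ.erase (0 : F)).image fun c ↦ c • 1) ?_ ?_).trans ?_
  · intro g hg
    obtain ⟨i, c, hi⟩ := hmem g hg x (by simp)
    obtain ⟨j, d, hj⟩ := hmem g hg y (by simp)
    refine Finset.mem_biUnion.2 ⟨(i, j), ?_, ?_⟩
    · simp only [Finset.mem_offDiag, Finset.mem_univ, true_and]
      rintro rfl
      exact hne g hg i c d hi hj
    · refine Finset.mem_product.2 ⟨?_, ?_⟩
      · dsimp only
        rw [hi]
        exact hR _ _ _ (by rw [← hi, (conj_trace_det g x.1).2])
      · dsimp only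
        rw [hj]
        exact hR _ _ _ (by rw [← hj, (conj_trace_det g y.1).2])
  · intro g g₀ h
    obtain ⟨h1, h2⟩ := Prod.mk.inj h
    obtain ⟨c, hc⟩ := exists_eq_smul_one_of_commute hxy (commute_of_conj_eq h1)
      (commute_of_conj_eq h2)
    refine Finset.mem_image.2 ⟨c, ?_, hc.symm⟩
    simp only [Finset.mem_erase, Finset.mem_univ, and_true]
    rintro rfl
    exact hd (g₀⁻¹ * g) (by rw [hc]; simp)
  · refine Nat.mul_le_mul ?_ (Finset.card_image_le.trans ?_)
    · refine (Finset.card_biUnion_le_card_mul _ _ 4 fun ij _ ↦ ?_).trans ?_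
      · rw [Finset.card_product]
        exact Nat.mul_le_mul (hRcard _ _) (hRcard _ _)
      · decide
    · simp

/-- A solvable subgroup of `GL₂(q)` has order at most `(q - 1) * (q * (q - 1))` or, in odd
characteristic, at most `24 * (q - 1)`. -/
theorem card_le_of_isSolvable [Finite F] (hq : 4 ≤ Nat.card F) (L : Subgroup (GL (Fin 2) F))
    [Group.IsSolvable L] :
    Nat.card L ≤ (Nat.card F - 1) * (Nat.card F * (Nat.card F - 1)) ∨
      ((2 : F) ≠ 0 ∧ Nat.card L ≤ 24 * (Nat.card F - 1)) := by
  classical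
  have := Fintype.ofFinite F
  let Sc : GL (Fin 2) F → Prop := fun g ↦ ∃ c : F, g.1 = c • 1
  by_cases hL : ∀ g ∈ L, Sc g
  · left
    refine card_le_of_conj_commute hq L !![0, 1; 0, 0] (fun c hc ↦ ?_) fun y hy ↦ ?_
    · simpa using congrFun₂ hc 0 1
    · obtain ⟨c, hc⟩ := hL y hy
      have h (x : Matrix (Fin 2) (Fin 2) F) : y.1 * x * y⁻¹.1 = x := by
        have : y.1 * x = x * y.1 := by rw [hc]; simp
        rw [this, mul_assoc, ← Units.val_mul, mul_inv_cancel, Units.val_one, mul_one]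
      rw [h]
  · have hex : ∃ n, ∀ g ∈ derivedSeries L n, Sc g.1 := by
      obtain ⟨n, hn⟩ := Group.IsSolvable.solvable (G := L)
      refine ⟨n, fun g hg ↦ ?_⟩
      rw [hn, Subgroup.mem_bot] at hg
      exact ⟨1, by rw [hg]; simp⟩
    have hn0 : Nat.find hex ≠ 0 := by
      intro h
      have := Nat.find_spec hex
      rw [h] at this
      exact hL fun g hg ↦ this ⟨g, hg⟩ (Subgroup.mem_top _)
    obtain ⟨m, hm⟩ := Nat.exists_eq_succ_of_ne_zero hn0
    have hm1 := Nat.find_min hex (m := m) (by omega)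
    have hm2 := Nat.find_spec hex
    rw [hm, Nat.succ_eq_add_one, derivedSeries_succ] at hm2
    set A := derivedSeries L m with hA
    have hcomm (a) (ha : a ∈ A) (b) (hb : b ∈ A) :
        a.1.1 * b.1.1 = b.1.1 * a.1.1 ∨
          ((2 : F) ≠ 0 ∧ a.1.1 * b.1.1 ≠ b.1.1 * a.1.1 ∧ a.1.1 * b.1.1 = -(b.1.1 * a.1.1)) := by
      obtain ⟨c, hc⟩ := hm2 _ (Subgroup.commutator_mem_commutator ha hb)
      have hab : a.1.1 * b.1.1 = c • (b.1.1 * a.1.1) := by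
        have h1 : a * b = (a * b * a⁻¹ * b⁻¹) * (b * a) := by group
        have h2 : a.1.1 * b.1.1 = (a * b * a⁻¹ * b⁻¹).1.1 * (b.1.1 * a.1.1) :=
          congrArg (fun g : L ↦ g.1.1) h1
        have hc' : (a * b * a⁻¹ * b⁻¹).1.1 = c • 1 := hc
        rw [h2, hc', smul_mul_assoc, one_mul]
      have hc2 : (c - 1) * (c + 1) = 0 := by
        have h1 := congrArg Matrix.det hab
        have h2 : (b.1.1 * a.1.1).det ≠ 0 := (Matrix.isUnits_det_units (b.1 * a.1)).ne_zero
        rw [Matrix.det_smul, Matrix.det_mul_comm, Fintype.card_fin] at h1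
        have h3 : c ^ 2 = 1 := mul_right_cancel₀ h2 (by rw [← h1, one_mul])
        linear_combination h3
      rcases mul_eq_zero.1 hc2 with h | h
      · left; rw [hab, sub_eq_zero.1 h, one_smul]
      · have hc := eq_neg_of_add_eq_zero_left h
        have hab' : a.1.1 * b.1.1 = -(b.1.1 * a.1.1) := by rw [hab, hc, neg_one_smul]
        by_cases h' : a.1.1 * b.1.1 = b.1.1 * a.1.1
        · exact Or.inl h'
        · refine Or.inr ⟨fun h2 ↦ h' ?_, h', hab'⟩
          rw [hab, hc, show (-1 : F) = 1 by linear_combination -h2, one_smul]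
    have hconj (g) (hg : g ∈ L) (a) (ha : a ∈ A) :
        ∃ a' ∈ A, a'.1.1 = g.1 * a.1.1 * g⁻¹.1 :=
      ⟨⟨g, hg⟩ * a * ⟨g, hg⟩⁻¹, (derivedSeries_normal L m).conj_mem a ha _, by
        simp only [Subgroup.coe_mul, Units.val_mul, Subgroup.coe_inv]⟩
    by_cases hab : ∀ a ∈ A, ∀ b ∈ A, a.1.1 * b.1.1 = b.1.1 * a.1.1
    · left
      push Not at hm1
      obtain ⟨x, hxA, hx⟩ := hm1
      refine card_le_of_conj_commute hq L x.1.1 (fun c hc ↦ hx ⟨c, hc⟩) fun y hy ↦ ?_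
      obtain ⟨a', ha', h⟩ := hconj y hy x hxA
      rw [← h]
      exact hab _ ha' _ hxA
    · right
      push Not at hab
      obtain ⟨x, hxA, y, hyA, hxy⟩ := hab
      obtain ⟨h2, -, hanti⟩ := (hcomm x hxA y hyA).resolve_left hxy
      refine ⟨h2, card_le_of_conj_anticommute L x.1 y.1 hxy hanti fun g hg w hw v hv ↦ ?_⟩
      have hin (w) (hw : w ∈ ({x.1, y.1} : Set (GL (Fin 2) F))) : ∃ w' ∈ A, w'.1 = w := by
        rcases hw with rfl | rfl
        · exact ⟨x, hxA, rfl⟩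
        · exact ⟨y, hyA, rfl⟩
      obtain ⟨w', hwA, rfl⟩ := hin w hw
      obtain ⟨v', hvA, rfl⟩ := hin v hv
      obtain ⟨a', ha', h⟩ := hconj g hg w' hwA
      rw [← h]
      exact (hcomm a' ha' v' hvA).imp_right fun h ↦ h.2.2

end SolvableLinear

section SolvableBound

variable {F : Type*} [Field F]

lemma exists_eq_smul_one_of_autProj_eq_one {y : GL (Fin 2) F} (h : autProj (glConj y) = 1) :
    ∃ c : F, y.1 = c • 1 := by
  have hyy : y⁻¹.1 * y.1 = 1 := by rw [← Units.val_mul, inv_mul_cancel]; rfl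
  have key (x : SL(2, F)) : y.1 * x.1 = x.1 * y.1 ∨
      (y.1 * x.1 = -(x.1 * y.1) ∧ x.1.trace = -x.1.trace) := by
    have h1 : proj (glConj y x) = proj x := by rw [← autProj_proj, h, MulAut.one_apply]
    have h2 (z : Matrix (Fin 2) (Fin 2) F) (hz : y.1 * x.1 * y⁻¹.1 = z) : y.1 * x.1 = z * y.1 := by
      rw [← hz, mul_assoc, hyy, mul_one]
    rcases proj_eq_iff.1 h1 with h1 | h1
    · exact Or.inl (h2 _ (congrArg Subtype.val h1))
    · have h3 : y.1 * x.1 * y⁻¹.1 = -x.1 := congrArg Subtype.val h1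
      refine Or.inr ⟨by rw [h2 _ h3, neg_mul], ?_⟩
      rw [← Matrix.trace_neg, ← h3, (conj_trace_det y x.1).1]
  have hu : y.1 * (upper 1 : SL(2, F)).1 = (upper 1 : SL(2, F)).1 * y.1 := by
    rcases key (upper 1) with h1 | ⟨h1, h2⟩
    · exact h1
    · have h4 : (2 : F) * 2 = 0 := by
        simp [Matrix.trace_fin_two] at h2
        linear_combination h2
      have h2 : (2 : F) = 0 := by simpa using h4
      have h3 : (-1 : F) = 1 := by linear_combination -h2
      rw [h1, ← neg_one_smul F, h3, one_smul]
  obtain ⟨a, b, hab⟩ := exists_eq_of_commute (x := (upper 1 : SL(2, F)).1) (fun c hc ↦ by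
    simpa using congrFun₂ hc 0 1) hu
  have hb : b = 0 := by
    rcases key weyl with h1 | ⟨h1, -⟩ <;> rw [hab] at h1 <;>
      simpa [add_mul, mul_add, eq_comm] using congrFun₂ h1 1 1
  exact ⟨a, by rw [hab, hb]; simp⟩

lemma glConj_scalar (c : Fˣ) : glConj (GeneralLinearGroup.scalar (Fin 2) c) = 1 := by
  ext1 x
  apply Subtype.ext
  have h : (GeneralLinearGroup.scalar (Fin 2) c).1 = (c : F) • 1 := by
    rw [Matrix.smul_one_eq_diagonal]; rfl
  have h2 : (GeneralLinearGroup.scalar (Fin 2) c).1 * x.1 =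
      x.1 * (GeneralLinearGroup.scalar (Fin 2) c).1 := by
    rw [h]; simp
  rw [glConj_coe, h2, mul_assoc, ← Units.val_mul, mul_inv_cancel]
  simp

theorem card_le_of_isSolvable_mulAut [Finite F] (p : ℕ) [Fact p.Prime] [CharP F p]
    (hq : 4 ≤ Nat.card F) (H : Subgroup (MulAut PSL(2, F))) [Group.IsSolvable H] :
    Nat.card H ≤ Nat.card (F ≃+* F) * (Nat.card F * (Nat.card F - 1)) ∨
      ((2 : F) ≠ 0 ∧ Nat.card H ≤ Nat.card (F ≃+* F) * 24) := by
  classical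
  have := Fintype.ofFinite F
  have hSLfin : Finite (Matrix (Fin 2) (Fin 2) F) := inferInstanceAs (Finite (Fin 2 → Fin 2 → F))
  have : Finite SL(2, F) := inferInstanceAs (Finite {A : Matrix (Fin 2) (Fin 2) F // A.det = 1})
  have : Finite PSL(2, F) := Quotient.finite _
  have : Finite (MulAut PSL(2, F)) := DFunLike.finite _
  have : Finite (F ≃+* F) := DFunLike.finite _
  have := Fintype.ofFinite (F ≃+* F)
  let Ψ : GL (Fin 2) F →* MulAut PSL(2, F) := autProj.comp glConj
  choose s δ σ hφ using fun φ ↦ exists_eq_conj_mul_fieldAut (F := F) p φ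
  let K := (H ⊓ Ψ.range : Subgroup (MulAut PSL(2, F)))
  have hHK : Nat.card H ≤ Nat.card (F ≃+* F) * Nat.card K := by
    have := card_le_mul_of_fibers (fun φ : H ↦ σ φ.1) Finset.univ (Nat.card K)
      (fun _ ↦ Finset.mem_univ _) fun φ₀ ↦ by
        refine Nat.card_le_card_of_injective
          (fun φ ↦ ⟨φ.1.1 * φ₀.1⁻¹, H.mul_mem φ.1.2 (H.inv_mem φ₀.2), ?_⟩) fun a b hab ↦ ?_
        · have e1 := hφ φ.1.1
          have e2 := hφ φ₀.1
          rw [show σ φ.1.1 = σ φ₀.1 from φ.2] at e1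
          refine ⟨(SpecialLinearGroup.toGL (s φ.1.1) * diagGL (δ φ.1.1)) *
            (SpecialLinearGroup.toGL (s φ₀.1) * diagGL (δ φ₀.1))⁻¹, ?_⟩
          rw [map_mul, map_inv]
          change autProj _ * (autProj _)⁻¹ = _
          refine Eq.trans ?_ (congrArg₂ (fun x y ↦ x * y⁻¹) e1.symm e2.symm)
          group
        · exact Subtype.ext (Subtype.ext (mul_right_cancel (Subtype.ext_iff.1 hab)))
    rwa [Finset.card_univ, ← Nat.card_eq_fintype_card] at this
  let L := H.comap Ψ
  have hKL : (Nat.card F - 1) * Nat.card K ≤ Nat.card L := by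
    have hu : Nat.card Fˣ = Nat.card F - 1 := by
      rw [Nat.card_eq_fintype_card, Nat.card_eq_fintype_card, Fintype.card_units]
    rw [← hu, ← Nat.card_prod]
    choose g hg using fun k : K ↦ k.2.2
    have hsc (c : Fˣ) : Ψ (GeneralLinearGroup.scalar (Fin 2) c) = 1 := by
      change autProj (glConj _) = 1
      rw [glConj_scalar, map_one]
    refine Nat.card_le_card_of_injective
      (fun ck ↦ ⟨GeneralLinearGroup.scalar (Fin 2) ck.1 * g ck.2, ?_⟩) fun a b hab ↦ ?_
    · change Ψ _ ∈ H
      rw [map_mul, hsc, one_mul, hg]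
      exact ck.2.2.1
    · have h1 := Subtype.ext_iff.1 hab
      have h2 := congrArg Ψ h1
      simp only [map_mul, hsc, one_mul, hg] at h2
      have h3 : a.2 = b.2 := Subtype.ext h2
      simp only [h3, mul_left_inj] at h1
      have h4 := congrArg (fun y : GL (Fin 2) F ↦ y.1 0 0) h1
      refine Prod.ext (Units.ext ?_) h3
      simpa [GeneralLinearGroup.scalar] using h4
  have hLsol : Group.IsSolvable L := by
    let Ψ' : L →* H := Ψ.subgroupComap H
    have : Group.IsSolvable Ψ'.ker := Group.isSolvable_of_comm fun a b ↦ by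
      have hex (a : Ψ'.ker) : ∃ c : F, a.1.1.1 = c • 1 :=
        exists_eq_smul_one_of_autProj_eq_one (Subtype.ext_iff.1 a.2)
      obtain ⟨c, hc⟩ := hex a
      obtain ⟨d, hd⟩ := hex b
      refine Subtype.ext (Subtype.ext (Units.ext ?_))
      change a.1.1.1 * b.1.1.1 = b.1.1.1 * a.1.1.1
      rw [hc, hd]
      simp [smul_smul, mul_comm]
    exact Group.isSolvable_of_ker_le_range Ψ'.ker.subtype Ψ' (by rw [Subgroup.range_subtype])
  have hq1 : 0 < Nat.card F - 1 := by omega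
  rcases card_le_of_isSolvable hq L with h | ⟨h2, h⟩
  · left
    exact hHK.trans (Nat.mul_le_mul_left _ (Nat.le_of_mul_le_mul_left (hKL.trans h) hq1))
  · right
    rw [mul_comm 24] at h
    exact ⟨h2, hHK.trans (Nat.mul_le_mul_left _ (Nat.le_of_mul_le_mul_left (hKL.trans h) hq1))⟩

lemma card_ringEquiv_galoisField_le (p f : ℕ) [Fact p.Prime] (hf : f ≠ 0) :
    Nat.card (GaloisField p f ≃+* GaloisField p f) ≤ f := by
  have h := IsGalois.card_aut_eq_finrank (ZMod p) (GaloisField p f)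
  rw [GaloisField.finrank p hf] at h
  have : Finite (GaloisField p f ≃ₐ[ZMod p] GaloisField p f) := inferInstance
  refine le_trans (Nat.card_le_card_of_injective (fun σ ↦ AlgEquiv.ofRingEquiv (f := σ) fun x ↦ ?_)
    fun a b hab ↦ ?_) h.le
  · exact DFunLike.congr_fun (Subsingleton.elim
      ((σ : GaloisField p f →+* GaloisField p f).comp (algebraMap (ZMod p) (GaloisField p f)))
      (algebraMap (ZMod p) (GaloisField p f))) x
  · ext x
    exact DFunLike.congr_fun hab x

theorem maxSolvableOrder_le (p f : ℕ) [Fact p.Prime] (hq : 4 ≤ p ^ f) :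
    maxSolvableOrder (MulAut PSL(2, GaloisField p f)) ≤ f * (p ^ f * (p ^ f - 1)) ∨
      (p ≠ 2 ∧ maxSolvableOrder (MulAut PSL(2, GaloisField p f)) ≤ f * 24) := by
  have hf : f ≠ 0 := by rintro rfl; simp at hq
  have hcard := GaloisField.card p f hf
  have ha := card_ringEquiv_galoisField_le p f hf
  have key (H : Subgroup (MulAut PSL(2, GaloisField p f))) (hH : IsSolvable H) :=
    @card_le_of_isSolvable_mulAut (GaloisField p f) _ _ p _ _ (by rw [hcard]; exact hq) H hH
  rw [hcard] at key
  by_cases hp : p = 2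
  · left
    refine csSup_le' ?_
    rintro n ⟨H, hH, rfl⟩
    refine ((key H hH).resolve_right fun h ↦ h.1 ?_).trans (Nat.mul_le_mul_right _ ha)
    subst hp
    exact CharTwo.two_eq_zero
  · rcases le_total (p ^ f * (p ^ f - 1)) 24 with h24 | h24
    · refine Or.inr ⟨hp, csSup_le' ?_⟩
      rintro n ⟨H, hH, rfl⟩
      rcases key H hH with h | ⟨-, h⟩
      · exact h.trans (Nat.mul_le_mul ha h24)
      · exact h.trans (Nat.mul_le_mul_right _ ha)
    · refine Or.inl (csSup_le' ?_)
      rintro n ⟨H, hH, rfl⟩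
      rcases key H hH with h | ⟨-, h⟩
      · exact h.trans (Nat.mul_le_mul_right _ ha)
      · exact h.trans (Nat.mul_le_mul ha h24)

end SolvableBound

section Representations

lemma simple_of_isIrreducible {G V : Type} [Group G] [Finite G] [AddCommGroup V] [Module ℂ V]
    [Module.Finite ℂ V] (ρ : Representation ℂ G V) (h : ρ.IsIrreducible) :
    CategoryTheory.Simple (FDRep.of ρ) := by
  classical
  have := Fintype.ofFinite G
  have hc : (Nat.card G : ℂ) ≠ 0 := by exact_mod_cast Nat.card_pos.ne'
  let _ : Invertible (Nat.card G : ℂ) := invertibleOfNonzero hc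
  rw [FDRep.simple_iff_char_is_norm_one]
  have h1 := Representation.char_orthonormal ρ ρ
  rw [if_pos ⟨Representation.Equiv.refl ρ⟩] at h1
  field_simp at h1
  exact h1

lemma exists_linearEquiv_of_autEquivalent {G : Type} [Group G] [Finite G] {V W : FDRep ℂ G}
    (hW : CategoryTheory.Simple W) (h : AutEquivalent V W) :
    ∃ (φ : G ≃* G) (T : W ≃ₗ[ℂ] V), ∀ g w, T (W.ρ g w) = V.ρ (φ g) (T w) := by
  classical
  have := Fintype.ofFinite G
  have hc : (Nat.card G : ℂ) ≠ 0 := by exact_mod_cast Nat.card_pos.ne'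
  let _ : Invertible (Nat.card G : ℂ) := invertibleOfNonzero hc
  obtain ⟨φ, hφ⟩ := h
  let V' : FDRep ℂ G := FDRep.of (V.ρ.comp φ.toMonoidHom)
  have hchar (g : G) : V'.character g = W.character g := hφ g
  have hV' : CategoryTheory.Simple V' := by
    rw [FDRep.simple_iff_char_is_norm_one] at hW ⊢
    simpa only [hchar] using hW
  have h1 := FDRep.char_orthonormal V' W
  have h2 := FDRep.char_orthonormal W W
  rw [if_pos ⟨CategoryTheory.Iso.refl W⟩] at h2
  simp only [hchar] at h1
  rw [h2] at h1
  obtain ⟨i⟩ : Nonempty (V' ≅ W) := by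
    by_contra h3
    rw [if_neg h3] at h1
    exact one_ne_zero h1
  refine ⟨φ, (FDRep.isoToLinearEquiv i).symm, fun g w ↦ ?_⟩
  rw [LinearEquiv.symm_apply_eq, FDRep.Iso.conj_ρ i g, LinearEquiv.conj_apply_apply]
  rfl

/-- A submodule stable under all the operators of a representation. -/
def IsInvariant {G V : Type} [Group G] [AddCommGroup V] [Module ℂ V] (ρ : Representation ℂ G V)
    (W : Submodule ℂ V) : Prop :=
  ∀ g, ∀ w ∈ W, ρ g w ∈ W

/-- A minimal nonzero invariant submodule. -/
structure IsMinimalInvariant {G V : Type} [Group G] [AddCommGroup V] [Module ℂ V]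
    (ρ : Representation ℂ G V) (W : Submodule ℂ V) : Prop where
  invariant : IsInvariant ρ W
  ne_bot : W ≠ ⊥
  eq_of_le : ∀ W' ≤ W, IsInvariant ρ W' → W' ≠ ⊥ → W' = W

lemma exists_isMinimalInvariant_le {G V : Type} [Group G] [AddCommGroup V] [Module ℂ V]
    [Module.Finite ℂ V] {ρ : Representation ℂ G V} {W : Submodule ℂ V} (h : IsInvariant ρ W)
    (h0 : W ≠ ⊥) : ∃ W' ≤ W, IsMinimalInvariant ρ W' := by
  obtain ⟨W', ⟨hle, hinv, hne⟩, hmin⟩ := WellFounded.has_min (wellFounded_lt (α := Submodule ℂ V))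
    {W' | W' ≤ W ∧ IsInvariant ρ W' ∧ W' ≠ ⊥} ⟨W, le_rfl, h, h0⟩
  refine ⟨W', hle, hinv, hne, fun W'' h1 h2 h3 ↦ ?_⟩
  by_contra h4
  exact hmin W'' ⟨h1.trans hle, h2, h3⟩ (lt_of_le_of_ne h1 h4)

variable {F : Type} [Field F]

theorem exists_fdRep [Finite F] {V : Type} [AddCommGroup V] [Module ℂ V] [Module.Finite ℂ V]
    {ρ : Representation ℂ SL(2, F) V} {W : Submodule ℂ V} (h : IsMinimalInvariant ρ W)
    (hneg : ∀ w ∈ W, ρ (-1) w = w) :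
    ∃ (X : FDRep ℂ PSL(2, F)) (e : W ≃ₗ[ℂ] X), CategoryTheory.Simple X ∧
      ∀ g (w : W), X.ρ (proj g) (e w) = e ⟨ρ g w, h.invariant g w w.2⟩ := by
  have hSLfin : Finite (Matrix (Fin 2) (Fin 2) F) := inferInstanceAs (Finite (Fin 2 → Fin 2 → F))
  have : Finite SL(2, F) := inferInstanceAs (Finite {A : Matrix (Fin 2) (Fin 2) F // A.det = 1})
  have : Finite PSL(2, F) := Quotient.finite _
  let S : Subrepresentation ρ := ⟨W, fun g w hw ↦ h.invariant g w hw⟩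
  let σ : SL(2, F) →* (W →ₗ[ℂ] W) := S.toRepresentation
  have hσ : Subgroup.center SL(2, F) ≤ σ.ker := by
    intro x hx
    have h1 : proj x = proj 1 := by
      rw [map_one]; exact (QuotientGroup.eq_one_iff x).2 hx
    rw [MonoidHom.mem_ker]
    rcases proj_eq_iff.1 h1 with rfl | rfl
    · exact map_one _
    · ext w
      exact hneg w w.2
  let τ : Representation ℂ PSL(2, F) W := QuotientGroup.lift _ σ hσ
  have hirr : τ.IsIrreducible := by
    have : Nontrivial (Subrepresentation τ) := by
      refine ⟨⟨⊥, fun _ v hv ↦ ?_⟩, ⟨⊤, fun _ _ _ ↦ trivial⟩, fun hbt ↦ ?_⟩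
      · rw [(Submodule.mem_bot ℂ).1 hv, map_zero]; exact Submodule.zero_mem _
      · have hbt : (⊥ : Submodule ℂ W) = ⊤ := congrArg Subrepresentation.toSubmodule hbt
        apply h.ne_bot
        rw [eq_bot_iff]
        intro w hw
        have : (⟨w, hw⟩ : W) ∈ (⊥ : Submodule ℂ W) := hbt ▸ trivial
        exact Subtype.ext_iff.1 ((Submodule.mem_bot ℂ).1 this)
    refine ⟨fun S' ↦ ?_⟩
    by_cases hS' : S'.toSubmodule = ⊥
    · exact Or.inl (Subrepresentation.toSubmodule_injective hS')
    · right
      have h1 := h.eq_of_le (S'.toSubmodule.map W.subtype) (Submodule.map_subtype_le _ _) (by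
        rintro g _ ⟨w, hw, rfl⟩
        exact ⟨_, S'.apply_mem_toSubmodule (proj g) hw, rfl⟩) (by
        rwa [Ne, ← Submodule.map_bot W.subtype,
          (Submodule.map_injective_of_injective W.injective_subtype).eq_iff])
      apply Subrepresentation.toSubmodule_injective
      change S'.toSubmodule = ⊤
      rw [eq_top_iff]
      rintro ⟨w, hw⟩ -
      rw [← h1] at hw
      obtain ⟨w', hw', rfl⟩ := hw
      exact hw'
  exact ⟨FDRep.of τ, LinearEquiv.refl ℂ W, simple_of_isIrreducible τ hirr, fun g w ↦ rfl⟩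

end Representations

section HighestWeights

variable {F : Type} [Field F]

/-- The existence of a nonzero vector fixed by the upper unipotent subgroup. -/
def HasFixedVector (X : FDRep ℂ PSL(2, F)) : Prop :=
  ∃ v : X, v ≠ 0 ∧ ∀ b, X.ρ (proj (upper b)) v = v

/-- The existence of a nonzero vector fixed by the upper unipotent subgroup on which the torus
acts through `ψ`. -/
def HasHighestWeight (X : FDRep ℂ PSL(2, F)) (ψ : F → ℂ) : Prop :=
  ∃ v : X, v ≠ 0 ∧ (∀ b, X.ρ (proj (upper b)) v = v) ∧ ∀ a : Fˣ, X.ρ (proj (diag a)) v = ψ a • v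

lemma HasHighestWeight.hasFixedVector {X : FDRep ℂ PSL(2, F)} {ψ : F → ℂ}
    (h : HasHighestWeight X ψ) : HasFixedVector X :=
  let ⟨v, h0, h1, _⟩ := h
  ⟨v, h0, h1⟩

/-- The highest weights are exactly `χ` and possibly its inverse. -/
structure IsOfType (X : FDRep ℂ PSL(2, F)) (χ : MulChar F ℂ) : Prop where
  hasHighestWeight : HasHighestWeight X χ
  eq_or_eq : ∀ ψ : F → ℂ, HasHighestWeight X ψ →
    (∀ a : Fˣ, ψ a = χ a) ∨ ∀ a : Fˣ, ψ a = χ⁻¹ a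

lemma exists_linearMap_of_autEquivalent [Finite F] (p : ℕ) [Fact p.Prime] [CharP F p]
    {V W : FDRep ℂ PSL(2, F)} (hW : CategoryTheory.Simple W) (h : AutEquivalent V W) :
    ∃ (δ : Fˣ) (σ : F ≃+* F) (T : W →ₗ[ℂ] V), Function.Injective T ∧
      (∀ b w, T (W.ρ (proj (upper b)) w) = V.ρ (proj (upper (δ * σ b))) (T w)) ∧
      ∀ a w, T (W.ρ (proj (diag a)) w) =
        V.ρ (proj (diag (Units.map σ.toMonoidHom a))) (T w) := by
  have hSLfin : Finite (Matrix (Fin 2) (Fin 2) F) := inferInstanceAs (Finite (Fin 2 → Fin 2 → F))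
  have : Finite SL(2, F) := inferInstanceAs (Finite {A : Matrix (Fin 2) (Fin 2) F // A.det = 1})
  have : Finite PSL(2, F) := Quotient.finite _
  obtain ⟨φ, T, hT⟩ := exists_linearEquiv_of_autEquivalent hW h
  obtain ⟨s, δ, σ, hφ⟩ := exists_eq_conj_mul_fieldAut p (φ : MulAut PSL(2, F))
  have key (x y : SL(2, F)) (hxy : glConj (diagGL δ) (fieldAut σ x) = y) (w : W) :
      V.ρ (proj s⁻¹) (T (W.ρ (proj x) w)) = V.ρ (proj y) (V.ρ (proj s⁻¹) (T w)) := by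
    have h1 : φ (proj x) = proj (s * y * s⁻¹) := by
      rw [hφ, map_mul glConj, map_mul autProj]
      change proj (glConj (SpecialLinearGroup.toGL s) (glConj (diagGL δ) (fieldAut σ x))) = _
      rw [hxy, glConj_toGL]
    rw [hT, h1, ← Module.End.mul_apply, ← Module.End.mul_apply, ← map_mul, ← map_mul, ← map_mul,
      ← map_mul]
    congr 3
    group
  refine ⟨δ, σ, V.ρ (proj s⁻¹) ∘ₗ T.toLinearMap, ?_, fun b w ↦ ?_, fun a w ↦ ?_⟩
  · refine Function.Injective.comp (g := V.ρ (proj s⁻¹)) ?_ T.injective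
    refine Function.LeftInverse.injective (g := V.ρ (proj s)) fun v ↦ ?_
    rw [← Module.End.mul_apply, ← map_mul, ← map_mul]
    simp
  · exact key _ _ (by rw [fieldAut_upper, glConj_diagGL_upper]) w
  · exact key _ _ (by rw [fieldAut_diag, glConj_diagGL_diag]) w

lemma HasFixedVector.of_autEquivalent [Finite F] (p : ℕ) [Fact p.Prime] [CharP F p]
    {V W : FDRep ℂ PSL(2, F)} (hW : CategoryTheory.Simple W) (h : AutEquivalent V W)
    (hf : HasFixedVector W) : HasFixedVector V := by
  obtain ⟨δ, σ, T, hT, hu, -⟩ := exists_linearMap_of_autEquivalent p hW h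
  obtain ⟨v, h0, hv⟩ := hf
  refine ⟨T v, fun h ↦ h0 (hT (by rw [h, map_zero])), fun b ↦ ?_⟩
  have h1 := hu (σ.symm ((δ⁻¹ : Fˣ) * b)) v
  rw [hv, RingEquiv.apply_symm_apply, Units.mul_inv_cancel_left] at h1
  exact h1.symm

lemma HasHighestWeight.of_autEquivalent [Finite F] (p : ℕ) [Fact p.Prime] [CharP F p]
    {V W : FDRep ℂ PSL(2, F)} (hW : CategoryTheory.Simple W) (h : AutEquivalent V W)
    {ψ : F → ℂ} (hf : HasHighestWeight W ψ) :
    ∃ σ : F ≃+* F, HasHighestWeight V (fun a ↦ ψ (σ a)) := by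
  obtain ⟨δ, σ, T, hT, hu, ht⟩ := exists_linearMap_of_autEquivalent p hW h
  obtain ⟨v, h0, hv, hv'⟩ := hf
  refine ⟨σ.symm, T v, fun h ↦ h0 (hT (by rw [h, map_zero])), fun b ↦ ?_, fun a ↦ ?_⟩
  · have h1 := hu (σ.symm ((δ⁻¹ : Fˣ) * b)) v
    rw [hv, RingEquiv.apply_symm_apply, Units.mul_inv_cancel_left] at h1
    exact h1.symm
  · have h1 := ht (Units.map σ.symm.toMonoidHom a) v
    have h2 : Units.map σ.toMonoidHom (Units.map σ.symm.toMonoidHom a) = a := by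
      ext; simp
    rw [hv', h2, map_smul] at h1
    exact h1.symm

lemma exists_ringEquiv_eq_pow [Finite F] (p : ℕ) [Fact p.Prime] [CharP F p] (σ : F ≃+* F) :
    ∃ i : ℕ, ∀ a, σ a = a ^ p ^ i := by
  have := Fintype.ofFinite F
  let _ := ZMod.algebra F p
  obtain ⟨i, hi⟩ := (FiniteField.bijective_frobeniusAlgEquivOfAlgebraic_pow (ZMod p) F).2
    (AlgEquiv.ofRingEquiv (f := σ) fun x ↦ DFunLike.congr_fun (Subsingleton.elim
      ((σ : F →+* F).comp (algebraMap (ZMod p) F)) (algebraMap (ZMod p) F)) x)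
  refine ⟨i, fun a ↦ ?_⟩
  have h := DFunLike.congr_fun hi a
  have h2 (n : ℕ) : (FiniteField.frobeniusAlgEquivOfAlgebraic (ZMod p) F ^ n) a = a ^ p ^ n := by
    induction n with
    | zero => simp
    | succ n ih => rw [pow_succ', AlgEquiv.mul_apply, ih]; simp [← pow_mul, pow_succ]
  rw [← h2]
  exact h.symm

lemma IsOfType.exists_pow_eq [Finite F] (p : ℕ) [Fact p.Prime] [CharP F p]
    {V W : FDRep ℂ PSL(2, F)} (hW : CategoryTheory.Simple W) (h : AutEquivalent V W)
    {χ χ' : MulChar F ℂ} (hχ : IsOfType V χ) (hχ' : IsOfType W χ') :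
    ∃ i : ℕ, χ' ^ p ^ i = χ ∨ χ' ^ p ^ i = χ⁻¹ := by
  obtain ⟨σ, hσ⟩ := hχ'.hasHighestWeight.of_autEquivalent p hW h
  obtain ⟨i, hi⟩ := exists_ringEquiv_eq_pow p σ
  refine ⟨i, (hχ.eq_or_eq _ hσ).imp (fun h ↦ ?_) fun h ↦ ?_⟩ <;>
  · ext a
    rw [← h a, hi, map_pow, MulChar.pow_apply_coe]

end HighestWeights

section PrincipalSeries

variable {F : Type} [Field F]

/-- The right regular representation of `SL₂` on complex-valued functions. -/
def reg : Representation ℂ SL(2, F) (SL(2, F) → ℂ) where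
  toFun g := LinearMap.funLeft ℂ ℂ (· * g)
  map_one' := by ext; simp [LinearMap.funLeft]
  map_mul' g h := by ext; simp [LinearMap.funLeft, mul_assoc]

@[simp] lemma reg_apply (g : SL(2, F)) (h : SL(2, F) → ℂ) (x : SL(2, F)) :
    reg g h x = h (x * g) := rfl

/-- The functions on `SL₂` transforming on the left under the Borel subgroup through `χ`. -/
def principal (χ : MulChar F ℂ) : Submodule ℂ (SL(2, F) → ℂ) where
  carrier := {h | (∀ b x, h (upper b * x) = h x) ∧ ∀ (a : Fˣ) x, h (diag a * x) = χ a * h x}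
  zero_mem' := by simp
  add_mem' := fun h h' ↦ ⟨fun b x ↦ by simp [h.1, h'.1], fun a x ↦ by simp [h.2, h'.2, mul_add]⟩
  smul_mem' := fun c h hh ↦ ⟨fun b x ↦ by simp [hh.1], fun a x ↦ by simp [hh.2]; ring⟩

lemma isInvariant_principal (χ : MulChar F ℂ) : IsInvariant reg (principal χ) :=
  fun g h hh ↦ ⟨fun b x ↦ by simp [mul_assoc, hh.1], fun a x ↦ by simp [mul_assoc, hh.2]⟩

lemma diag_neg_one : (diag (-1) : SL(2, F)) = -1 := by
  apply sl_ext <;> simp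

lemma neg_apply_of_mem_principal {χ : MulChar F ℂ} (hχ : χ (-1) = 1) {h : SL(2, F) → ℂ}
    (hh : h ∈ principal χ) : reg (-1) h = h := by
  ext x
  rw [reg_apply, mul_neg, mul_one, ← neg_one_mul, ← diag_neg_one, hh.2]
  simp [hχ]

lemma mul_inv_apply (χ : MulChar F ℂ) (a : Fˣ) : χ a * χ ((a⁻¹ : Fˣ) : F) = 1 := by
  rw [← map_mul, Units.mul_inv, map_one]

lemma weyl_mul_diag (a : Fˣ) : (weyl : SL(2, F)) * diag a = diag a⁻¹ * weyl := by
  apply sl_ext <;> simp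

/-- A function in `principal χ` fixed by the upper unipotent subgroup. -/
lemma eq_of_apply_one_of_apply_weyl {χ : MulChar F ℂ} {h h' : SL(2, F) → ℂ}
    (hh : h ∈ principal χ) (hh' : h' ∈ principal χ) (hu : ∀ b, reg (upper b) h = h)
    (hu' : ∀ b, reg (upper b) h' = h') (h1 : h 1 = h' 1) (hw : h weyl = h' weyl) : h = h' := by
  ext x
  by_cases hx : x.1 1 0 = 0
  · obtain ⟨a, b, rfl⟩ := eq_upper_mul_diag hx
    rw [hh.1, hh'.1, ← mul_one (diag a), hh.2, hh'.2, h1]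
  · obtain ⟨a, b, c, rfl⟩ := eq_upper_mul_weyl_mul hx
    have key (k : SL(2, F) → ℂ) (hk : k ∈ principal χ) (hu : ∀ b, reg (upper b) k = k) :
        k (upper b * weyl * (upper c * diag a)) = χ (a⁻¹ : Fˣ) * k weyl := by
      have h2 : (upper c * diag a : SL(2, F)) = diag a * upper (((a⁻¹ : Fˣ) : F) ^ 2 * c) := by
        rw [diag_mul_upper]
        congr 2
        simp
      rw [mul_assoc, hk.1, h2, ← mul_assoc, weyl_mul_diag, mul_assoc, hk.2, ← reg_apply (upper _) k weyl, hu]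
    rw [key h hh hu, key h' hh' hu', hw]

lemma exists_fixed_of_ne_bot [Fintype F] {χ : MulChar F ℂ} {W : Submodule ℂ (SL(2, F) → ℂ)}
    (hW : W ≤ principal χ) (hinv : IsInvariant reg W) (h0 : W ≠ ⊥) :
    ∃ h ∈ W, h 1 ≠ 0 ∧ (∀ b, reg (upper b) h = h) ∧
      ∀ a : Fˣ, reg (diag a) h = χ a • h := by
  classical
  obtain ⟨k, hk, hk0⟩ := (Submodule.ne_bot_iff _).1 h0
  obtain ⟨x, hx⟩ := Function.ne_iff.1 hk0
  have hk1 := hinv x k hk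
  let k2 : SL(2, F) → ℂ := ∑ b : F, reg (upper b) (reg x k)
  let k3 : SL(2, F) → ℂ := ∑ a : Fˣ, χ ((a⁻¹ : Fˣ) : F) • reg (diag a) k2
  have hk2 : k2 ∈ W := Submodule.sum_mem _ fun b _ ↦ hinv _ _ hk1
  have hk3 : k3 ∈ W := Submodule.sum_mem _ fun b _ ↦ Submodule.smul_mem _ _ (hinv _ _ hk2)
  have hmul (g g' : SL(2, F)) (h : SL(2, F) → ℂ) : reg g (reg g' h) = reg (g * g') h := by
    rw [map_mul]; rfl
  have hk2u (c : F) : reg (upper c) k2 = k2 := by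
    simp only [k2, map_sum]
    refine (Finset.sum_congr rfl fun b _ ↦ ?_).trans (Equiv.sum_comp (Equiv.addLeft c)
      fun b ↦ reg (upper b) (reg x k))
    rw [hmul, ← upper_add]
    rfl
  refine ⟨k3, hk3, ?_, fun c ↦ ?_, fun c ↦ ?_⟩
  · have h2 : k2 1 = Fintype.card F * k x := by
      simp only [k2, Finset.sum_apply, reg_apply, one_mul]
      rw [Finset.sum_congr rfl fun b _ ↦ (hW hk).1 b x]
      simp
    have h3 : k3 1 = Fintype.card Fˣ * k2 1 := by
      simp only [k3, Finset.sum_apply, Pi.smul_apply, reg_apply, one_mul]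
      refine (Finset.sum_congr rfl fun a _ ↦ (?_ : _ = k2 1)).trans (by simp)
      rw [← mul_one (diag a), (hW hk2).2, smul_eq_mul, ← mul_assoc, mul_comm (χ _),
        mul_inv_apply, one_mul]
    rw [h3, h2]
    have : (Fintype.card F : ℂ) ≠ 0 := by exact_mod_cast Fintype.card_ne_zero
    have : (Fintype.card Fˣ : ℂ) ≠ 0 := by exact_mod_cast Fintype.card_ne_zero
    simp_all
  · simp only [k3, map_sum, map_smul]
    refine Finset.sum_congr rfl fun a _ ↦ ?_
    have h2 : (upper c * diag a : SL(2, F)) = diag a * upper (((a⁻¹ : Fˣ) : F) ^ 2 * c) := by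
      rw [diag_mul_upper]
      congr 2
      simp
    rw [hmul, h2, ← hmul, hk2u]
  · simp only [k3, map_sum, map_smul, Finset.smul_sum]
    refine (Finset.sum_congr rfl fun a _ ↦ ?_).trans (Equiv.sum_comp (Equiv.mulLeft c)
      fun a : Fˣ ↦ χ (c : F) • χ ((a⁻¹ : Fˣ) : F) • reg (diag a) k2)
    rw [hmul, ← diag_mul]
    simp only [Equiv.coe_mulLeft, smul_smul]
    congr 1
    rw [mul_inv, Units.val_mul, map_mul, ← mul_assoc, mul_inv_apply, one_mul]

lemma eq_or_eq_inv_of_eigenvector {χ : MulChar F ℂ} {h : SL(2, F) → ℂ} (hh : h ∈ principal χ)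
    (h0 : h ≠ 0) (hu : ∀ b, reg (upper b) h = h) {ψ : F → ℂ}
    (hψ : ∀ a : Fˣ, reg (diag a) h = ψ a • h) :
    (∀ a : Fˣ, ψ a = χ a) ∨ ∀ a : Fˣ, ψ a = χ⁻¹ a := by
  by_cases h1 : h 1 = 0
  · right
    have hw : h weyl ≠ 0 := fun hw ↦ h0 (eq_of_apply_one_of_apply_weyl hh
      (Submodule.zero_mem _) hu (by simp) h1 hw)
    intro a
    have h2 := congrFun (hψ a) weyl
    rw [reg_apply, weyl_mul_diag, hh.2] at h2
    rw [MulChar.inv_apply', ← Units.val_inv_eq_inv_val]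
    exact (mul_right_cancel₀ hw h2).symm
  · left
    intro a
    have h2 := congrFun (hψ a) 1
    rw [reg_apply, one_mul, ← mul_one (diag a), hh.2] at h2
    exact (mul_right_cancel₀ h1 h2).symm

theorem exists_fdRep_isOfType [Fintype F] {χ : MulChar F ℂ} (hχ : χ (-1) = 1)
    {W : Submodule ℂ (SL(2, F) → ℂ)} (hW : W ≤ principal χ) (h : IsMinimalInvariant reg W) :
    ∃ X : FDRep ℂ PSL(2, F), CategoryTheory.Simple X ∧ IsOfType X χ ∧
      Module.finrank ℂ X = Module.finrank ℂ W := by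
  have hSLfin : Finite (Matrix (Fin 2) (Fin 2) F) := inferInstanceAs (Finite (Fin 2 → Fin 2 → F))
  have : Finite SL(2, F) := inferInstanceAs (Finite {A : Matrix (Fin 2) (Fin 2) F // A.det = 1})
  obtain ⟨X, e, hX, he⟩ := exists_fdRep h fun w hw ↦ neg_apply_of_mem_principal hχ (hW hw)
  refine ⟨X, hX, ⟨?_, ?_⟩, e.finrank_eq.symm⟩
  · obtain ⟨k, hk, hk1, hu, ht⟩ := exists_fixed_of_ne_bot hW h.invariant h.ne_bot
    refine ⟨e ⟨k, hk⟩, ?_, fun b ↦ ?_, fun a ↦ ?_⟩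
    · rw [Ne, e.map_eq_zero_iff]
      rintro h0
      exact hk1 (congrFun (congrArg Subtype.val h0) 1)
    · rw [he]
      simp only [hu]
    · rw [he, ← map_smul]
      exact congrArg e (Subtype.ext (ht a))
  · rintro ψ ⟨v, hv0, hv, hv'⟩
    obtain ⟨⟨k, hk⟩, rfl⟩ := e.surjective v
    refine eq_or_eq_inv_of_eigenvector (hW hk) (fun h0 ↦ hv0 ?_) (fun b ↦ ?_) fun a ↦ ?_
    · subst h0
      exact map_zero e
    · have := hv b
      rw [he] at this
      exact congrArg Subtype.val (e.injective this)
    · have := hv' a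
      rw [he, ← map_smul] at this
      exact congrArg Subtype.val (e.injective this)

end PrincipalSeries

section PrincipalSeriesIrreducible

variable {F : Type} [Field F]

lemma finite_sl [Finite F] : Finite SL(2, F) := by
  have hSLfin : Finite (Matrix (Fin 2) (Fin 2) F) := inferInstanceAs (Finite (Fin 2 → Fin 2 → F))
  exact inferInstanceAs (Finite {A : Matrix (Fin 2) (Fin 2) F // A.det = 1})

lemma sum_smul_reg_inv [Fintype SL(2, F)] {χ : MulChar F ℂ} {φ g : SL(2, F) → ℂ}
    (hφ : φ ∈ principal χ) (hg : g ∈ principal χ) (hg0 : ∀ z : SL(2, F), z.1 1 0 ≠ 0 → g z = 0) :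
    ∑ x, φ x • reg x⁻¹ g = (Nat.card {z : SL(2, F) // z.1 1 0 = 0} * g 1) • φ := by
  classical
  ext x
  simp only [Finset.sum_apply, Pi.smul_apply, reg_apply, smul_eq_mul]
  rw [← Equiv.sum_comp ((Equiv.inv SL(2, F)).trans (Equiv.mulRight x))]
  have key (z : SL(2, F)) : φ (z⁻¹ * x) * g (x * (z⁻¹ * x)⁻¹) =
      if z.1 1 0 = 0 then g 1 * φ x else 0 := by
    rw [show x * (z⁻¹ * x)⁻¹ = z by group]
    split_ifs with hz
    · obtain ⟨a, b, rfl⟩ := eq_upper_mul_diag hz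
      have h1 : φ x = χ a * φ ((upper b * diag a)⁻¹ * x) := by
        rw [← hφ.2, ← hφ.1 b (diag a * _)]
        congr 1
        group
      have h2 : g (upper b * diag a) = χ a * g 1 := by
        rw [hg.1, ← hg.2, mul_one]
      rw [h1, h2]
      ring
    · rw [hg0 z hz, mul_zero]
  refine (Finset.sum_congr rfl fun z _ ↦ key z).trans ?_
  rw [← Finset.sum_filter, Finset.sum_const, Nat.card_eq_fintype_card, Fintype.card_subtype,
    nsmul_eq_mul, mul_assoc]

lemma sum_smul_reg_mem [Fintype SL(2, F)] {W : Submodule ℂ (SL(2, F) → ℂ)}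
    (hW : IsInvariant reg W) {g : SL(2, F) → ℂ} (hg : g ∈ W) (φ : SL(2, F) → ℂ) :
    ∑ x, φ x • reg x⁻¹ g ∈ W :=
  Submodule.sum_mem _ fun _ _ ↦ Submodule.smul_mem _ _ (hW _ _ hg)

lemma card_borel_ne_zero [Finite F] :
    (Nat.card {z : SL(2, F) // z.1 1 0 = 0} : ℂ) ≠ 0 := by
  have := finite_sl (F := F)
  have : Nonempty {z : SL(2, F) // z.1 1 0 = 0} := ⟨1, by simp⟩
  exact_mod_cast Nat.card_pos.ne'

lemma apply_eq_of_fixed {χ : MulChar F ℂ} {h : SL(2, F) → ℂ} (hh : h ∈ principal χ)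
    (hu : ∀ b, reg (upper b) h = h) {z : SL(2, F)} (hz : z.1 1 0 ≠ 0) :
    ∃ a : Fˣ, h z = χ a * h weyl := by
  obtain ⟨a, b, c, rfl⟩ := eq_upper_mul_weyl_mul hz
  refine ⟨a⁻¹, ?_⟩
  have h2 : (upper c * diag a : SL(2, F)) = diag a * upper (((a⁻¹ : Fˣ) : F) ^ 2 * c) := by
    rw [diag_mul_upper]
    congr 2
    simp
  rw [mul_assoc, hh.1, h2, ← mul_assoc, weyl_mul_diag, mul_assoc, hh.2,
    ← reg_apply (upper _) h weyl, hu]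

/-- A linear parametrization of `principal χ` by the points of the projective line. -/
noncomputable def ofProjectiveLine (χ : MulChar F ℂ) : (Option F → ℂ) →ₗ[ℂ] (SL(2, F) → ℂ) := by
  classical exact
  { toFun m x := if x.1 1 0 = 0 then χ⁻¹ (x.1 1 1) * m none
      else χ⁻¹ (x.1 1 0) * m (some (x.1 1 1 / x.1 1 0))
    map_add' m m' := by
      ext x
      simp only [Pi.add_apply]
      split_ifs <;> ring
    map_smul' c m := by
      ext x
      simp only [Pi.smul_apply, smul_eq_mul, RingHom.id_apply]
      split_ifs <;> ring }

lemma ofProjectiveLine_apply (χ : MulChar F ℂ) (m : Option F → ℂ) (x : SL(2, F)) [DecidableEq F] :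
    ofProjectiveLine χ m x = if x.1 1 0 = 0 then χ⁻¹ (x.1 1 1) * m none
      else χ⁻¹ (x.1 1 0) * m (some (x.1 1 1 / x.1 1 0)) := by
  simp only [ofProjectiveLine, LinearMap.coe_mk, AddHom.coe_mk]
  split_ifs <;> rfl

lemma ofProjectiveLine_mem (χ : MulChar F ℂ) (m : Option F → ℂ) :
    ofProjectiveLine χ m ∈ principal χ := by
  classical
  refine ⟨fun b x ↦ ?_, fun a x ↦ ?_⟩
  · have h0 : (upper b * x).1 1 0 = x.1 1 0 := by
      simp [Matrix.mul_apply]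
    have h1 : (upper b * x).1 1 1 = x.1 1 1 := by
      simp [Matrix.mul_apply]
    rw [ofProjectiveLine_apply, ofProjectiveLine_apply, h0, h1]
  · have h0 : (diag a * x).1 1 0 = (a : F)⁻¹ * x.1 1 0 := by
      simp [Matrix.mul_apply]
    have h1 : (diag a * x).1 1 1 = (a : F)⁻¹ * x.1 1 1 := by
      simp [Matrix.mul_apply]
    have h2 (y : F) : χ⁻¹ ((a : F)⁻¹ * y) = χ a * χ⁻¹ y := by
      rw [map_mul, MulChar.inv_apply', inv_inv]
    have ha : (a : F)⁻¹ ≠ 0 := inv_ne_zero a.ne_zero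
    rw [ofProjectiveLine_apply, ofProjectiveLine_apply, h0, h1]
    simp only [mul_eq_zero, ha, false_or, h2, mul_div_mul_left _ _ ha]
    split_ifs <;> ring

lemma ofProjectiveLine_injective {χ : MulChar F ℂ} (hχ : χ (-1) = 1) :
    Function.Injective (ofProjectiveLine χ) := by
  classical
  rw [← LinearMap.ker_eq_bot, LinearMap.ker_eq_bot']
  intro m hm
  have hχ' : χ⁻¹ (-1) = 1 := by
    rw [MulChar.inv_apply', inv_neg, inv_one, hχ]
  ext (_ | c)
  · have := congrFun hm 1
    rw [ofProjectiveLine_apply] at this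
    simpa using this
  · have := congrFun hm (weyl * upper c)
    rw [ofProjectiveLine_apply] at this
    simpa [hχ'] using this

lemma card_lt_finrank_principal [Fintype F] {χ : MulChar F ℂ} (hχ : χ (-1) = 1) :
    Fintype.card F + 1 ≤ Module.finrank ℂ (principal χ) := by
  have := finite_sl (F := F)
  have h := LinearMap.finrank_le_finrank_of_injective
    (f := (ofProjectiveLine χ).codRestrict (principal χ) (ofProjectiveLine_mem χ))
    ((LinearMap.injective_codRestrict_iff _).2 (ofProjectiveLine_injective hχ))
  simpa using h

theorem isMinimalInvariant_principal [Fintype F] {χ : MulChar F ℂ} (hχ : χ (-1) = 1)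
    (hχ2 : χ ^ 2 ≠ 1) : IsMinimalInvariant reg (principal χ) := by
  have := finite_sl (F := F)
  have := Fintype.ofFinite SL(2, F)
  refine ⟨isInvariant_principal χ, fun h ↦ ?_, fun W hW hinv h0 ↦ le_antisymm hW fun φ hφ ↦ ?_⟩
  · have := card_lt_finrank_principal hχ
    rw [h, finrank_bot] at this
    omega
  · obtain ⟨g, hg, hg1, hu, ht⟩ := exists_fixed_of_ne_bot hW hinv h0
    have hw : g weyl = 0 := by
      by_contra hw
      refine hχ2 (MulChar.ext fun a ↦ ?_)
      have h2 := congrFun (ht a) weyl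
      rw [reg_apply, weyl_mul_diag, (hW hg).2] at h2
      have h3 := mul_right_cancel₀ hw h2
      rw [MulChar.pow_apply_coe, pow_two, MulChar.one_apply_coe]
      nth_rw 2 [← h3]
      exact mul_inv_apply χ a
    have h3 := sum_smul_reg_inv hφ (hW hg) fun z hz ↦ by
      obtain ⟨a, ha⟩ := apply_eq_of_fixed (hW hg) hu hz
      rw [ha, hw, mul_zero]
    have h4 := sum_smul_reg_mem hinv hg φ
    rw [h3] at h4
    exact (Submodule.smul_mem_iff _ (mul_ne_zero card_borel_ne_zero hg1)).1 h4

/-- The functions in `principal 1` of mean zero. -/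
def steinberg (F : Type) [Field F] [Fintype SL(2, F)] : Submodule ℂ (SL(2, F) → ℂ) where
  carrier := {h | h ∈ principal 1 ∧ ∑ x, h x = 0}
  zero_mem' := ⟨Submodule.zero_mem _, by simp⟩
  add_mem' := fun h h' ↦ ⟨Submodule.add_mem _ h.1 h'.1, by
    simp [Finset.sum_add_distrib, h.2, h'.2]⟩
  smul_mem' := fun c h hh ↦ ⟨Submodule.smul_mem _ c hh.1, by simp [← Finset.mul_sum, hh.2]⟩

lemma const_mem_principal (c : ℂ) : (fun _ ↦ c : SL(2, F) → ℂ) ∈ principal 1 :=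
  ⟨fun _ _ ↦ rfl, fun a _ ↦ by simp⟩

lemma card_le_finrank_steinberg [Fintype F] [Fintype SL(2, F)] :
    Fintype.card F ≤ Module.finrank ℂ (steinberg F) := by
  have h1 := card_lt_finrank_principal (F := F) (χ := 1) (by
    simpa using MulChar.one_apply_coe (R' := ℂ) (-1 : Fˣ))
  have h2 : principal 1 ≤ steinberg F ⊔ Submodule.span ℂ {fun _ ↦ 1} := by
    intro h hh
    have hc : (Fintype.card SL(2, F) : ℂ) ≠ 0 := by exact_mod_cast Fintype.card_ne_zero
    obtain ⟨c, hc⟩ : ∃ c : ℂ, c = (∑ x, h x) / Fintype.card SL(2, F) := ⟨_, rfl⟩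
    refine Submodule.mem_sup.2 ⟨h - fun _ ↦ c, ⟨Submodule.sub_mem _ hh (const_mem_principal c), ?_⟩,
      fun _ ↦ c, Submodule.mem_span_singleton.2 ⟨c, by ext; simp⟩, by simp⟩
    simp only [Pi.sub_apply, Finset.sum_sub_distrib, Finset.sum_const, Finset.card_univ, hc,
      nsmul_eq_mul]
    field_simp
    simp
  have h3 := Submodule.finrank_mono h2
  have h4 := Submodule.finrank_add_le_finrank_add_finrank (steinberg F)
    (Submodule.span ℂ {fun _ ↦ (1 : ℂ)})
  have h5 : Module.finrank ℂ (Submodule.span ℂ {(fun _ ↦ 1 : SL(2, F) → ℂ)}) ≤ 1 :=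
    (finrank_span_le_card _).trans (by simp)
  omega

theorem isMinimalInvariant_steinberg [Fintype F] [Fintype SL(2, F)] :
    IsMinimalInvariant reg (steinberg F) := by
  have hle : steinberg F ≤ principal 1 := fun h hh ↦ hh.1
  refine ⟨fun g h hh ↦ ⟨isInvariant_principal 1 g h hh.1, ?_⟩, fun h ↦ ?_,
    fun W hW hinv h0 ↦ le_antisymm hW fun φ hφ ↦ ?_⟩
  · exact (Equiv.sum_comp (Equiv.mulRight g) h).trans hh.2
  · have := card_le_finrank_steinberg (F := F)
    rw [h, finrank_bot] at this
    have := Fintype.card_pos (α := F)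
    omega
  · obtain ⟨g, hg, hg1, hu, -⟩ := exists_fixed_of_ne_bot (hW.trans hle) hinv h0
    have hgw (z : SL(2, F)) (hz : z.1 1 0 ≠ 0) : g z = g weyl := by
      obtain ⟨a, ha⟩ := apply_eq_of_fixed (hle (hW hg)) hu hz
      rw [ha, MulChar.one_apply_coe, one_mul]
    have hne : g 1 - g weyl ≠ 0 := by
      intro h
      have hconst (z : SL(2, F)) : g z = g 1 := by
        by_cases hz : z.1 1 0 = 0
        · obtain ⟨a, b, rfl⟩ := eq_upper_mul_diag hz
          rw [(hle (hW hg)).1, ← mul_one (diag a), (hle (hW hg)).2, MulChar.one_apply_coe, one_mul]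
        · rw [hgw z hz, sub_eq_zero.1 h]
      have h2 := (hW hg).2
      simp only [hconst, Finset.sum_const, Finset.card_univ, nsmul_eq_mul, mul_eq_zero,
        Nat.cast_eq_zero, Fintype.card_ne_zero, hg1, or_self] at h2
    have h3 := sum_smul_reg_inv (hle hφ)
      (Submodule.sub_mem _ (hle (hW hg)) (const_mem_principal (g weyl))) fun z hz ↦ by
        simp [hgw z hz]
    have h4 := sum_smul_reg_mem hinv hg φ
    have h5 : ∑ x, φ x • reg x⁻¹ (g - fun _ ↦ g weyl) = ∑ x, φ x • reg x⁻¹ g := by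
      ext y
      simp only [map_sub, smul_sub, Finset.sum_sub_distrib, Pi.sub_apply, Finset.sum_apply,
        Pi.smul_apply, reg_apply, smul_eq_mul, ← Finset.sum_mul, hφ.2, zero_mul, sub_zero]
    rw [h5] at h3
    rw [h3] at h4
    exact (Submodule.smul_mem_iff _ (mul_ne_zero card_borel_ne_zero hne)).1 h4

end PrincipalSeriesIrreducible

section Weights

variable {F : Type} [Field F]

lemma reg_reg (g g' : SL(2, F)) (h : SL(2, F) → ℂ) : reg g (reg g' h) = reg (g * g') h := by
  rw [map_mul]; rfl

/-- The sum projecting (up to a scalar) onto the weight space of weight `ψ (s * ·)`. -/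
noncomputable def weightSum [Fintype F] (ψ : AddChar F ℂ) (s : F) :
    (SL(2, F) → ℂ) →ₗ[ℂ] (SL(2, F) → ℂ) :=
  ∑ b : F, ψ (-(s * b)) • reg (upper b)

/-- The weights of the upper unipotent subgroup on `W`. -/
def weights (ψ : AddChar F ℂ) (W : Submodule ℂ (SL(2, F) → ℂ)) : Set F :=
  {s | ∃ h ∈ W, h ≠ 0 ∧ ∀ c, reg (upper c) h = ψ (s * c) • h}

variable {ψ : AddChar F ℂ} {W : Submodule ℂ (SL(2, F) → ℂ)}

lemma weightSum_apply [Fintype F] (s : F) (h : SL(2, F) → ℂ) :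
    weightSum ψ s h = ∑ b : F, ψ (-(s * b)) • reg (upper b) h := by
  simp [weightSum]

lemma weightSum_mem [Fintype F] (hW : IsInvariant reg W) (s : F) {h : SL(2, F) → ℂ} (hh : h ∈ W) :
    weightSum ψ s h ∈ W := by
  rw [weightSum_apply]
  exact Submodule.sum_mem _ fun b _ ↦ Submodule.smul_mem _ _ (hW _ _ hh)

lemma reg_upper_weightSum [Fintype F] (s c : F) (h : SL(2, F) → ℂ) :
    reg (upper c) (weightSum ψ s h) = ψ (s * c) • weightSum ψ s h := by
  simp only [weightSum_apply, map_sum, map_smul, Finset.smul_sum]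
  rw [← Equiv.sum_comp (Equiv.addLeft c) fun b ↦ ψ (s * c) • ψ (-(s * b)) • reg (upper b) h]
  refine Finset.sum_congr rfl fun b _ ↦ ?_
  simp only [Equiv.coe_addLeft, smul_smul]
  rw [reg_reg, ← upper_add, ← AddChar.map_add_eq_mul]
  congr 2
  ring

lemma weightSum_of_weight [Fintype F] [DecidableEq F] (hψ : ψ.IsPrimitive) {s t : F}
    {h : SL(2, F) → ℂ} (hh : ∀ c, reg (upper c) h = ψ (t * c) • h) :
    weightSum ψ s h = if s = t then (Fintype.card F : ℂ) • h else 0 := by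
  rw [weightSum_apply]
  have h1 (b : F) : ψ (-(s * b)) • reg (upper b) h = ψ (b * (t - s)) • h := by
    rw [hh, smul_smul, ← AddChar.map_add_eq_mul]
    congr 2
    ring
  simp only [h1, ← Finset.sum_smul]
  rw [AddChar.sum_mulShift _ hψ]
  by_cases hst : s = t
  · simp [hst]
  · simp [hst, sub_ne_zero.2 (Ne.symm hst)]

lemma sum_weightSum [Fintype F] (hψ : ψ.IsPrimitive) (h : SL(2, F) → ℂ) :
    ∑ s, weightSum ψ s h = (Fintype.card F : ℂ) • h := by
  classical
  simp only [weightSum_apply]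
  rw [Finset.sum_comm]
  simp only [← Finset.sum_smul]
  have h1 (b : F) : ∑ s, ψ (-(s * b)) = if b = 0 then (Fintype.card F : ℂ) else 0 := by
    have := AddChar.sum_mulShift (-b) hψ
    simp only [mul_neg, neg_eq_zero] at this
    rw [this]
    split_ifs <;> simp
  simp only [h1, ite_smul, zero_smul, Finset.sum_ite_eq', Finset.mem_univ, if_true, upper_zero,
    map_one, Module.End.one_apply]

lemma ncard_weights_le_finrank [Finite F] (hψ : ψ.IsPrimitive) :
    (weights ψ W).ncard ≤ Module.finrank ℂ W := by
  classical
  have := Fintype.ofFinite F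
  have := finite_sl (F := F)
  choose v hvW hv0 hv using fun s : weights ψ W ↦ s.2
  have hli : LinearIndependent ℂ (fun s ↦ (⟨v s, hvW s⟩ : W)) := by
    rw [linearIndependent_iff']
    intro t g hg i hi
    have h1 : ∑ s ∈ t, g s • v s = 0 := by
      simpa using congrArg Subtype.val hg
    have h2 := congrArg (weightSum ψ i.1) h1
    simp only [map_sum, map_smul, map_zero] at h2
    rw [Finset.sum_eq_single i] at h2
    · rw [weightSum_of_weight hψ (hv i), if_pos rfl] at h2
      have : (Fintype.card F : ℂ) ≠ 0 := by exact_mod_cast Fintype.card_ne_zero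
      simpa [this, hv0] using h2
    · intro j _ hj
      rw [weightSum_of_weight hψ (hv j), if_neg (fun h ↦ hj (Subtype.ext h).symm), smul_zero]
    · exact fun h ↦ (h hi).elim
  have h3 := hli.fintype_card_le_finrank
  rwa [← Nat.card_eq_fintype_card, Nat.card_coe_set_eq] at h3

lemma exists_ne_zero_mem_weights [Finite F] (hψ : ψ.IsPrimitive) (hW : IsInvariant reg W)
    {h : SL(2, F) → ℂ} (hh : h ∈ W) {b : F} (hb : reg (upper b) h ≠ h) :
    ∃ s ∈ weights ψ W, s ≠ 0 := by
  classical
  have := Fintype.ofFinite F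
  by_contra! hall
  have h1 (s : F) (hs : s ≠ 0) : weightSum ψ s h = 0 := by
    by_contra h2
    exact hs (hall s ⟨_, weightSum_mem hW s hh, h2, fun c ↦ reg_upper_weightSum s c h⟩)
  have h2 := sum_weightSum hψ h
  rw [Finset.sum_eq_single 0 (fun s _ hs ↦ h1 s hs) (by simp)] at h2
  have h3 := reg_upper_weightSum (ψ := ψ) 0 b h
  rw [h2, zero_mul, AddChar.map_zero_eq_one, one_smul, map_smul] at h3
  have : (Fintype.card F : ℂ) ≠ 0 := by exact_mod_cast Fintype.card_ne_zero
  exact hb (smul_right_injective _ this h3)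

lemma mul_sq_mem_weights (hW : IsInvariant reg W) {s : F} (hs : s ∈ weights ψ W) (a : Fˣ) :
    s * (a : F) ^ 2 ∈ weights ψ W := by
  obtain ⟨h, hh, h0, hu⟩ := hs
  refine ⟨reg (diag a⁻¹) h, hW _ _ hh, fun h1 ↦ h0 ?_, fun c ↦ ?_⟩
  · have h2 := congrArg (reg (diag a)) h1
    rw [reg_reg, ← diag_mul, mul_inv_cancel, map_zero] at h2
    rw [← h2]
    ext x
    rw [reg_apply]
    congr 1
    have : (diag 1 : SL(2, F)) = 1 := by apply sl_ext <;> simp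
    rw [this, mul_one]
  · have h2 : (upper c * diag a⁻¹ : SL(2, F)) = diag a⁻¹ * upper ((a : F) ^ 2 * c) := by
      rw [diag_mul_upper]
      congr 2
      simp
    rw [reg_reg, h2, ← reg_reg, hu, map_smul]
    congr 2
    ring

lemma card_squares_le_finrank [Finite F] (hψ : ψ.IsPrimitive) (hW : IsInvariant reg W)
    {h : SL(2, F) → ℂ} (hh : h ∈ W) {b : F} (hb : reg (upper b) h ≠ h) :
    Nat.card (powMonoidHom 2 : Fˣ →* Fˣ).range ≤ ((weights ψ W) \ {0}).ncard := by
  obtain ⟨s, hs, hs0⟩ := exists_ne_zero_mem_weights hψ hW hh hb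
  have : Finite F := inferInstance
  rw [← Nat.card_coe_set_eq]
  refine Nat.card_le_card_of_injective (fun y ↦ ⟨s * (y.1 : F), ?_⟩) fun y z hyz ↦ ?_
  · obtain ⟨_, a, rfl⟩ := y
    refine ⟨?_, ?_⟩
    · simpa using mul_sq_mem_weights hW hs a
    · simp [hs0]
  · exact Subtype.ext (Units.ext (mul_left_cancel₀ hs0 (Subtype.ext_iff.1 hyz)))

lemma exists_isPrimitive [Finite F] : ∃ ψ : AddChar F ℂ, ψ.IsPrimitive := by
  obtain ⟨ψ, hψ⟩ := AddChar.exists_apply_ne_zero.2 (one_ne_zero (α := F))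
  exact ⟨ψ, AddChar.IsPrimitive.of_ne_one fun h ↦ hψ (by simp [h])⟩

lemma card_le_two_mul_card_squares [Finite F] :
    Nat.card F - 1 ≤ 2 * Nat.card (powMonoidHom 2 : Fˣ →* Fˣ).range := by
  have := Fintype.ofFinite F
  have h1 := (powMonoidHom 2 : Fˣ →* Fˣ).ker.card_mul_index
  rw [Subgroup.index_ker, Nat.card_units] at h1
  rw [← h1]
  refine Nat.mul_le_mul_right _ ?_
  have h2 : Nat.card (powMonoidHom 2 : Fˣ →* Fˣ).ker ≤ Nat.card Bool := by
    classical
    refine Nat.card_le_card_of_injective (fun x ↦ decide (x.1 = 1)) fun x y hxy ↦ ?_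
    have h3 (x : (powMonoidHom 2 : Fˣ →* Fˣ).ker) : x.1 = 1 ∨ x.1 = -1 := by
      have := Units.ext_iff.1 x.2
      have h4 : (x.1 : F) ^ 2 = 1 := by simpa using this
      rw [pow_two, mul_self_eq_one_iff] at h4
      exact h4.imp (fun h ↦ Units.ext h) fun h ↦ Units.ext (by simpa using h)
    have h4 : (x.1 = 1) ↔ (y.1 = 1) := by simpa using hxy
    refine Subtype.ext ?_
    rcases h3 x with hx | hx
    · rw [hx, h4.1 hx]
    · rcases h3 y with hy | hy
      · rw [hy, h4.2 hy]
      · rw [hx, hy]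
  simpa using h2

lemma card_squares_of_two_eq_zero [Finite F] (h2 : (2 : F) = 0) :
    Nat.card (powMonoidHom 2 : Fˣ →* Fˣ).range = Nat.card F - 1 := by
  have h1 := (powMonoidHom 2 : Fˣ →* Fˣ).ker.card_mul_index
  rw [Subgroup.index_ker, Nat.card_units] at h1
  have h3 : (powMonoidHom 2 : Fˣ →* Fˣ).ker = ⊥ := by
    rw [eq_bot_iff]
    intro x hx
    have h4 : (x : F) ^ 2 = 1 := by simpa using Units.ext_iff.1 hx
    have h5 : ((x : F) - 1) ^ 2 = 0 := by linear_combination h4 - (x - 1 : F) * h2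
    exact Units.ext (sub_eq_zero.1 (pow_eq_zero_iff two_ne_zero |>.1 h5))
  rw [h3] at h1
  simpa using h1

lemma card_squares_le_finrank_of_fixed_eq_zero [Finite F] (hW : IsInvariant reg W) (h0 : W ≠ ⊥)
    (hfix : ∀ h ∈ W, (∀ b, reg (upper b) h = h) → h = 0) :
    Nat.card (powMonoidHom 2 : Fˣ →* Fˣ).range ≤ Module.finrank ℂ W := by
  obtain ⟨ψ, hψ⟩ := exists_isPrimitive (F := F)
  obtain ⟨h, hh, hne⟩ := (Submodule.ne_bot_iff _).1 h0
  obtain ⟨b, hb⟩ : ∃ b, reg (upper b) h ≠ h := by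
    by_contra! hb
    exact hne (hfix h hh hb)
  exact (card_squares_le_finrank hψ hW hh hb).trans
    ((Set.ncard_le_ncard Set.sdiff_subset).trans (ncard_weights_le_finrank hψ))

lemma card_squares_lt_finrank_of_le_principal [Finite F] {χ : MulChar F ℂ} (hχ : χ ≠ 1)
    (hle : W ≤ principal χ) (hW : IsInvariant reg W) (h0 : W ≠ ⊥) :
    Nat.card (powMonoidHom 2 : Fˣ →* Fˣ).range + 1 ≤ Module.finrank ℂ W := by
  have := Fintype.ofFinite F
  obtain ⟨ψ, hψ⟩ := exists_isPrimitive (F := F)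
  obtain ⟨h, hh, h1, hu, -⟩ := exists_fixed_of_ne_bot hle hW h0
  obtain ⟨k, hk, b, hb⟩ : ∃ k ∈ W, ∃ b, reg (upper b) k ≠ k := by
    by_contra! hall
    obtain ⟨a, ha⟩ := MulChar.ne_one_iff.1 hχ
    have key (a : Fˣ) : reg (diag a) h = reg (weyl * weyl * weyl) h := by
      rw [diag_eq_word]
      simp only [← reg_reg]
      have hw (k : SL(2, F) → ℂ) (hk : k ∈ W) : reg weyl k ∈ W := hW _ _ hk
      rw [hall _ (hw _ hh), hall _ (hw _ (hw _ hh)), hall _ (hw _ (hw _ (hw _ hh)))]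
    have h2 := congrFun ((key a).trans (key 1).symm) 1
    simp only [reg_apply, one_mul] at h2
    rw [← mul_one (diag a), ← mul_one (diag 1), (hle hh).2, (hle hh).2, Units.val_one, map_one]
      at h2
    exact ha (mul_right_cancel₀ h1 h2)
  have h3 := card_squares_le_finrank hψ hW hk hb
  have h4 : (0 : F) ∈ weights ψ W := ⟨h, hh, fun h2 ↦ h1 (by rw [h2]; rfl), fun c ↦ by
    rw [hu, zero_mul, AddChar.map_zero_eq_one, one_smul]⟩
  have h5 := Set.ncard_sdiff_singleton_add_one h4
  have h6 := ncard_weights_le_finrank (W := W) hψ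
  omega

end Weights

section Cuspidal

variable {F : Type} [Field F]

/-- The even functions on `SL₂` whose sums over all cosets of unipotent subgroups vanish. -/
def cuspidal (F : Type) [Field F] [Fintype F] : Submodule ℂ (SL(2, F) → ℂ) where
  carrier := {h | (∀ x, h (-x) = h x) ∧ ∀ x y, ∑ b : F, h (x * upper b * y) = 0}
  zero_mem' := by simp
  add_mem' := fun h h' ↦ ⟨fun x ↦ by simp [h.1, h'.1], fun x y ↦ by
    simp [Finset.sum_add_distrib, h.2, h'.2]⟩
  smul_mem' := fun c h hh ↦ ⟨fun x ↦ by simp [hh.1], fun x y ↦ by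
    simp [← Finset.mul_sum, hh.2]⟩

lemma isInvariant_cuspidal [Fintype F] : IsInvariant reg (cuspidal F) :=
  fun g h hh ↦ ⟨fun x ↦ by simp [hh.1], fun x y ↦ by simp [mul_assoc, ← hh.2 x (y * g)]⟩

lemma eq_zero_of_mem_cuspidal [Fintype F] {h : SL(2, F) → ℂ} (hh : h ∈ cuspidal F)
    (hu : ∀ b, reg (upper b) h = h) : h = 0 := by
  ext x
  have h1 := hh.2 x 1
  have h2 (b : F) : h (x * upper b * 1) = h x := by
    rw [mul_one, ← reg_apply (upper b) h x, hu]
  rw [Finset.sum_congr rfl fun b _ ↦ h2 b] at h1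
  simpa using h1

open Classical in
/-- The elements of the field which are not traces of split semisimple elements. -/
noncomputable def ellipticTraces (F : Type) [Field F] [Fintype F] : Finset F :=
  {s | ¬ ∃ a : Fˣ, s = a + (a : F)⁻¹}

lemma card_ellipticTraces_ne_zero [Fintype F] : (ellipticTraces F).card ≠ 0 := by
  classical
  intro h
  rw [Finset.card_eq_zero, ellipticTraces, Finset.filter_eq_empty_iff] at h
  have hs : Function.Surjective (fun a : Fˣ ↦ (a : F) + (a : F)⁻¹) := fun s ↦ by
    obtain ⟨a, ha⟩ := not_not.1 (h (Finset.mem_univ s))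
    exact ⟨a, ha.symm⟩
  have h1 := Fintype.card_le_of_surjective _ hs
  have h2 := Fintype.card_units F
  have h3 := Fintype.card_pos (α := F)
  omega

open Classical in
/-- The values at noncentral elements of a cuspidal class function, in terms of the trace. -/
noncomputable def cuspidalTraceFun (F : Type) [Field F] [Fintype F] (s : F) : ℂ :=
  (if s = 2 ∨ s = -2 then -((ellipticTraces F).card : ℂ) else 0) +
    if s ∈ ellipticTraces F then ((Finset.univ.filter fun s : F ↦ s = 2 ∨ s = -2).card : ℂ) else 0

open Classical in
/-- A nonzero cuspidal class function. -/
noncomputable def cuspidalClassFun (F : Type) [Field F] [Fintype F] (x : SL(2, F)) : ℂ :=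
  if x = 1 ∨ x = -1 then ((Fintype.card F : ℂ) - 1) * (ellipticTraces F).card
  else cuspidalTraceFun F x.1.trace

lemma not_mem_ellipticTraces [Fintype F] {s : F} (a : Fˣ) (h : s = a + (a : F)⁻¹) :
    s ∉ ellipticTraces F := by
  classical
  simp only [ellipticTraces, Finset.mem_filter, not_and, not_not]
  exact fun _ ↦ ⟨a, h⟩

lemma not_mem_ellipticTraces_of_eq [Fintype F] {s : F} (h : s = 2 ∨ s = -2) :
    s ∉ ellipticTraces F := by
  rcases h with rfl | rfl
  · exact not_mem_ellipticTraces 1 (by simp; norm_num)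
  · exact not_mem_ellipticTraces (-1) (by simp; norm_num)

lemma sum_cuspidalTraceFun [Fintype F] : ∑ s : F, cuspidalTraceFun F s = 0 := by
  classical
  simp only [cuspidalTraceFun, Finset.sum_add_distrib, ← Finset.sum_filter, Finset.sum_const,
    nsmul_eq_mul]
  rw [Finset.filter_mem_eq_inter, Finset.univ_inter]
  ring_nf

lemma neg_mem_ellipticTraces [Fintype F] {s : F} :
    -s ∈ ellipticTraces F ↔ s ∈ ellipticTraces F := by
  have key (s : F) (h : s ∈ ellipticTraces F) : -s ∈ ellipticTraces F := by
    classical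
    simp only [ellipticTraces, Finset.mem_filter, Finset.mem_univ, true_and] at h ⊢
    rintro ⟨a, ha⟩
    exact h ⟨-a, by rw [Units.val_neg, inv_neg]; linear_combination -ha⟩
  exact ⟨fun h ↦ by simpa using key _ h, key s⟩

lemma cuspidalTraceFun_neg [Fintype F] (s : F) :
    cuspidalTraceFun F (-s) = cuspidalTraceFun F s := by
  classical
  have h : (-s = 2 ∨ -s = -2) ↔ (s = 2 ∨ s = -2) := by
    rw [neg_inj, neg_eq_iff_eq_neg]; exact or_comm
  exact congrArg₂ (· + ·) (if_congr h rfl rfl) (if_congr neg_mem_ellipticTraces rfl rfl)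

lemma cuspidalClassFun_neg [Fintype F] (x : SL(2, F)) :
    cuspidalClassFun F (-x) = cuspidalClassFun F x := by
  classical
  have h : (-x = 1 ∨ -x = -1) ↔ (x = 1 ∨ x = -1) := by
    rw [neg_inj, neg_eq_iff_eq_neg]; exact or_comm
  exact if_congr h rfl ((congrArg _ (Matrix.trace_neg x.1)).trans (cuspidalTraceFun_neg _))

lemma cuspidalClassFun_conj [Fintype F] (x y : SL(2, F)) :
    cuspidalClassFun F (x * y * x⁻¹) = cuspidalClassFun F y := by
  classical
  have h1 : (x * y * x⁻¹ = 1 ∨ x * y * x⁻¹ = -1) ↔ (y = 1 ∨ y = -1) := by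
    refine or_congr (by simp) ?_
    rw [mul_inv_eq_iff_eq_mul, neg_one_mul, ← mul_neg_one, mul_right_inj]
  have h2 : (x * y * x⁻¹).1.trace = y.1.trace := by
    have h3 : (x⁻¹).1 * x.1 = 1 := congrArg Subtype.val (inv_mul_cancel x)
    change (x.1 * y.1 * (x⁻¹).1).trace = _
    rw [Matrix.trace_mul_comm, ← mul_assoc, h3, one_mul]
  exact if_congr h1 rfl (congrArg _ h2)

lemma sum_cuspidalClassFun [Fintype F] (g : SL(2, F)) :
    ∑ b, cuspidalClassFun F (g * upper b) = 0 := by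
  classical
  by_cases hg : g.1 1 0 = 0
  · obtain ⟨a, b₀, rfl⟩ := eq_upper_mul_diag hg
    have key (b₀ : F) : ∑ b, cuspidalClassFun F (upper b₀ * upper b) = 0 := by
      have h1 (b : F) : cuspidalClassFun F (upper b) =
          -((ellipticTraces F).card : ℂ) +
            if b = 0 then (Fintype.card F : ℂ) * (ellipticTraces F).card else 0 := by
        by_cases hb : b = 0
        · simp only [hb, upper_zero, cuspidalClassFun, true_or, if_true]
          ring
        · have h2 : ¬ (upper b = 1 ∨ upper b = -1) := by
            rintro (h | h) <;> have := congrFun₂ (congrArg Subtype.val h) 0 1 <;> simp [hb] at this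
          have h3 : (upper b).1.trace = 2 := by
            simp [Matrix.trace_fin_two]; norm_num
          simp only [cuspidalClassFun, h2, if_false, h3, cuspidalTraceFun, true_or, if_true, hb]
          rw [if_neg (not_mem_ellipticTraces_of_eq (Or.inl rfl))]
      simp only [← upper_add]
      refine (Equiv.sum_comp (Equiv.addLeft b₀) fun b ↦ cuspidalClassFun F (upper b)).trans ?_
      simp only [h1, Finset.sum_add_distrib, Finset.sum_const, Finset.card_univ,
        Finset.sum_ite_eq', Finset.mem_univ, if_true, nsmul_eq_mul]
      ring
    by_cases ha : a = 1
    · have : (diag 1 : SL(2, F)) = 1 := by apply sl_ext <;> simp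
      rw [ha, this, mul_one, key]
    by_cases ha' : a = -1
    · simp only [ha', diag_neg_one, mul_neg, mul_one, neg_mul, cuspidalClassFun_neg, key]
    refine Finset.sum_eq_zero fun b _ ↦ ?_
    have h1 : (upper b₀ * diag a * upper b).1 0 0 = a := by
      simp [Matrix.mul_apply]
    have h2 : (upper b₀ * diag a * upper b).1.trace = a + (a : F)⁻¹ := by
      simp [Matrix.trace_fin_two]
    have h3 : ¬ (upper b₀ * diag a * upper b = 1 ∨ upper b₀ * diag a * upper b = -1) := by
      rintro (h | h)
      · rw [h] at h1
        exact ha (Units.ext (by simpa using h1.symm))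
      · rw [h] at h1
        exact ha' (Units.ext (by simpa using h1.symm))
    have h4 : ¬ ((a : F) + (a : F)⁻¹ = 2 ∨ (a : F) + (a : F)⁻¹ = -2) := by
      have h5 : (a : F) * (a : F)⁻¹ = 1 := mul_inv_cancel₀ a.ne_zero
      rintro (h | h)
      · have h6 : ((a : F) - 1) ^ 2 = 0 := by linear_combination (a : F) * h - h5
        exact ha (Units.ext (sub_eq_zero.1 (pow_eq_zero_iff two_ne_zero |>.1 h6)))
      · have h6 : ((a : F) + 1) ^ 2 = 0 := by linear_combination (a : F) * h - h5
        refine ha' (Units.ext ?_)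
        rw [Units.val_neg, Units.val_one]
        exact eq_neg_of_add_eq_zero_left (pow_eq_zero_iff two_ne_zero |>.1 h6)
    simp only [cuspidalClassFun, h3, if_false, h2, cuspidalTraceFun, h4]
    rw [if_neg (not_mem_ellipticTraces a rfl), add_zero]
  · have h1 (b : F) : cuspidalClassFun F (g * upper b) =
        cuspidalTraceFun F (g.1.trace + g.1 1 0 * b) := by
      have h2 : (g * upper b).1 1 0 = g.1 1 0 := by simp [Matrix.mul_apply]
      have h3 : ¬ (g * upper b = 1 ∨ g * upper b = -1) := by
        rintro (h | h) <;> rw [h] at h2 <;> exact hg (by simpa using h2.symm)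
      have h4 : (g * upper b).1.trace = g.1.trace + g.1 1 0 * b := by
        simp [Matrix.trace_fin_two, Matrix.mul_apply]
        ring
      rw [cuspidalClassFun, if_neg h3, h4]
    simp only [h1]
    rw [← sum_cuspidalTraceFun (F := F)]
    exact ((Equiv.mulLeft₀ _ hg).trans (Equiv.addLeft g.1.trace)).sum_comp (cuspidalTraceFun F)

lemma cuspidal_ne_bot [Fintype F] : cuspidal F ≠ ⊥ := by
  rw [Submodule.ne_bot_iff]
  refine ⟨cuspidalClassFun F, ⟨cuspidalClassFun_neg, fun x y ↦ ?_⟩, fun h ↦ ?_⟩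
  · rw [← sum_cuspidalClassFun (y * x)]
    refine Finset.sum_congr rfl fun b _ ↦ ?_
    rw [← cuspidalClassFun_conj y]
    congr 1
    group
  · have h1 := congrFun h 1
    have h2 : (Fintype.card F : ℂ) - 1 ≠ 0 := by
      rw [sub_ne_zero]
      exact_mod_cast Fintype.one_lt_card.ne'
    have h3 : ((ellipticTraces F).card : ℂ) ≠ 0 := by
      exact_mod_cast card_ellipticTraces_ne_zero
    simp [cuspidalClassFun, h2, h3] at h1

theorem exists_cuspidal_fdRep [Finite F] :
    ∃ X : FDRep ℂ PSL(2, F), CategoryTheory.Simple X ∧ ¬ HasFixedVector X ∧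
      Nat.card (powMonoidHom 2 : Fˣ →* Fˣ).range ≤ Module.finrank ℂ X := by
  have := Fintype.ofFinite F
  have := finite_sl (F := F)
  obtain ⟨W, hW, h⟩ := exists_isMinimalInvariant_le (isInvariant_cuspidal (F := F)) cuspidal_ne_bot
  obtain ⟨X, e, hX, he⟩ := exists_fdRep h fun w hw ↦ by
    ext x
    rw [reg_apply, mul_neg, mul_one, (hW hw).1]
  refine ⟨X, hX, ?_, ?_⟩
  · rintro ⟨v, hv0, hv⟩
    obtain ⟨⟨k, hk⟩, rfl⟩ := e.surjective v
    refine hv0 ((e.map_eq_zero_iff).2 (Subtype.ext (eq_zero_of_mem_cuspidal (hW hk) fun b ↦ ?_)))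
    have := hv b
    rw [he] at this
    exact congrArg Subtype.val (e.injective this)
  · rw [← e.finrank_eq]
    exact card_squares_le_finrank_of_fixed_eq_zero h.invariant h.ne_bot
      fun k hk hu ↦ eq_zero_of_mem_cuspidal (hW hk) hu

end Cuspidal

section FiveElements

variable {F : Type} [Field F]

lemma character_proj_eq (X : FDRep ℂ PSL(2, F)) {x y P : SL(2, F)} (h : P * x = y * P) :
    X.character (proj x) = X.character (proj y) := by
  rw [← X.char_conj (proj x) (proj P), ← map_mul, h, map_mul, mul_inv_cancel_right]

lemma character_diag_eq_zero [Finite F] {X : FDRep ℂ PSL(2, F)} (hX : ¬ HasFixedVector X)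
    {a : Fˣ} (ha : (a : F) ^ 2 ≠ 1) : X.character (proj (diag a)) = 0 := by
  have := Fintype.ofFinite F
  have h1 : ∑ b, X.ρ (proj (upper b)) = (0 : X →ₗ[ℂ] X) := by
    ext v
    by_contra hv
    refine hX ⟨_, hv, fun c ↦ ?_⟩
    simp only [LinearMap.sum_apply, map_sum, ← Module.End.mul_apply, ← map_mul, ← upper_add]
    exact Equiv.sum_comp (Equiv.addLeft c) fun b ↦ X.ρ (proj (upper b)) v
  have h2 (b : F) : X.character (proj (diag a * upper b)) = X.character (proj (diag a)) := by
    have h3 : (a : F) ^ 2 - 1 ≠ 0 := sub_ne_zero.2 ha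
    refine character_proj_eq X (P := upper ((a : F) ^ 2 * b / ((a : F) ^ 2 - 1))) ?_ |>.trans rfl
    apply sl_ext <;> simp
    field_simp
    ring
  have h3 : ∑ b, X.character (proj (diag a * upper b)) = 0 := by
    have h4 : X.ρ (proj (diag a)) * ∑ b, X.ρ (proj (upper b)) = 0 := by rw [h1, mul_zero]
    rw [Finset.mul_sum] at h4
    simp only [← map_mul] at h4
    have h5 := congrArg (LinearMap.trace ℂ X) h4
    rwa [map_sum, map_zero] at h5
  simp only [h2, Finset.sum_const, Finset.card_univ, nsmul_eq_mul] at h3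
  exact (mul_eq_zero.1 h3).resolve_left (by exact_mod_cast Fintype.card_ne_zero)

lemma four_dvd_finrank [Finite F] (h5 : (5 : F) = 0) {X : FDRep ℂ PSL(2, F)}
    (hX : ¬ HasFixedVector X) : 4 ∣ Module.finrank ℂ X := by
  have h6 : (2 : F) * 3 = 1 := by linear_combination h5
  have h7 : (3 : F) * 2 = 1 := by linear_combination h5
  let a : Fˣ := ⟨2, 3, h6, h7⟩
  have ha0 : (a : F) = 2 := rfl
  have ha1 : (2 : F)⁻¹ = 3 := (eq_inv_of_mul_eq_one_left h7).symm
  have h2 : (2 : F) ≠ 0 := left_ne_zero_of_mul_eq_one h6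
  have ha : (a : F) ^ 2 ≠ 1 := fun h ↦ h2 (by rw [ha0] at h; linear_combination h5 - h)
  have ht := character_diag_eq_zero hX ha
  have hw : X.character (proj weyl) = 0 := by
    rw [← ht]
    obtain ⟨P, hP⟩ : ∃ P : SL(2, F), P.1 = !![1, -2; -1, -2] :=
      ⟨⟨_, by rw [Matrix.det_fin_two_of]; linear_combination -h5⟩, rfl⟩
    refine character_proj_eq X (P := P) ?_
    apply sl_ext <;> simp [ha1, ha0, hP]
    all_goals first | linear_combination h5 | linear_combination -h5
  have htw : X.character (proj (diag a * weyl)) = 0 := by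
    rw [← ht]
    obtain ⟨P, hP⟩ : ∃ P : SL(2, F), P.1 = !![1, 1; 2, -2] :=
      ⟨⟨_, by rw [Matrix.det_fin_two_of]; linear_combination -h5⟩, rfl⟩
    refine character_proj_eq X (P := P) ?_
    apply sl_ext <;> simp [ha1, ha0, hP]
    all_goals first | ring1 | linear_combination -h5 | linear_combination 2 * h5
  set t := proj (diag a)
  set w := proj (weyl : SL(2, F))
  have htt : t * t = 1 := by
    rw [← map_mul, ← map_one proj, proj_eq_iff]
    right
    apply sl_ext <;> simp [ha1, ha0]
    all_goals first | linear_combination h5 | linear_combination 2 * h5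
  have hww : w * w = 1 := by
    rw [← map_mul, ← map_one proj, proj_eq_iff]
    right
    apply sl_ext <;> simp
  have hwt : w * t = t * w := by
    rw [← map_mul, ← map_mul, proj_eq_iff]
    right
    apply sl_ext <;> simp [ha1, ha0]
    all_goals first | linear_combination h5 | linear_combination -h5
  let E : X →ₗ[ℂ] X := (1 / 4 : ℂ) • ((1 + X.ρ t) * (1 + X.ρ w))
  have hT : X.ρ t * X.ρ t = 1 := by rw [← map_mul, htt, map_one]
  have hW : X.ρ w * X.ρ w = 1 := by rw [← map_mul, hww, map_one]
  have hWT : X.ρ w * X.ρ t = X.ρ t * X.ρ w := by rw [← map_mul, hwt, map_mul]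
  have hE : IsIdempotentElem E := by
    have h8 : (1 + X.ρ t) * (1 + X.ρ t) = (2 : ℂ) • (1 + X.ρ t) := by
      rw [mul_add, add_mul, add_mul, hT, two_smul]; simp; abel
    have h9 : (1 + X.ρ w) * (1 + X.ρ w) = (2 : ℂ) • (1 + X.ρ w) := by
      rw [mul_add, add_mul, add_mul, hW, two_smul]; simp; abel
    have h10 : (1 + X.ρ w) * (1 + X.ρ t) = (1 + X.ρ t) * (1 + X.ρ w) := by
      rw [mul_add, add_mul, add_mul, mul_add, add_mul, add_mul, hWT]; simp; abel
    change E * E = E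
    simp only [E, smul_mul_assoc, mul_smul_comm, smul_smul]
    rw [mul_assoc, ← mul_assoc (1 + X.ρ w), h10, mul_assoc (1 + X.ρ t) (1 + X.ρ w), h9,
      ← mul_assoc, h8]
    simp only [smul_mul_assoc, mul_smul_comm, smul_smul]
    norm_num
  have htr := (LinearMap.IsIdempotentElem.isProj_range E hE).trace
  have htr' : LinearMap.trace ℂ X E = (1 / 4 : ℂ) * Module.finrank ℂ X := by
    have h8 : (1 + X.ρ t) * (1 + X.ρ w) = X.ρ 1 + X.ρ t + X.ρ w + X.ρ (t * w) := by
      rw [mul_add, add_mul, add_mul, map_mul, map_one]; simp; abel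
    simp only [E, h8, map_smul, map_add, smul_eq_mul]
    change (1 / 4 : ℂ) *
      (X.character 1 + X.character t + X.character w + X.character (t * w)) = _
    rw [ht, hw, X.char_one, ← map_mul, htw]
    ring
  rw [htr'] at htr
  refine ⟨Module.finrank ℂ (LinearMap.range E), ?_⟩
  have : (Module.finrank ℂ X : ℂ) = 4 * Module.finrank ℂ (LinearMap.range E) := by
    rw [← htr]; ring
  exact_mod_cast this

end FiveElements

section Triples

variable {F : Type} [Field F]

/-- The existence of three pairwise non-`Aut`-equivalent irreducible representations the product
of whose degrees is at least `N`. -/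
def HasNonEquivalentTriple (F : Type) [Field F] (N : ℕ) : Prop :=
  ∃ V₁ V₂ V₃ : FDRep ℂ PSL(2, F),
    CategoryTheory.Simple V₁ ∧ CategoryTheory.Simple V₂ ∧ CategoryTheory.Simple V₃ ∧
    ¬ AutEquivalent V₁ V₂ ∧ ¬ AutEquivalent V₁ V₃ ∧ ¬ AutEquivalent V₂ V₃ ∧
    N ≤ Module.finrank ℂ V₁ * Module.finrank ℂ V₂ * Module.finrank ℂ V₃

lemma exists_isOfType_principal [Finite F] {χ : MulChar F ℂ} (hχ : χ (-1) = 1) (hχ2 : χ ^ 2 ≠ 1) :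
    ∃ X : FDRep ℂ PSL(2, F), CategoryTheory.Simple X ∧ IsOfType X χ ∧
      Nat.card F + 1 ≤ Module.finrank ℂ X := by
  have := Fintype.ofFinite F
  obtain ⟨X, hX, hX', h⟩ := exists_fdRep_isOfType hχ le_rfl (isMinimalInvariant_principal hχ hχ2)
  refine ⟨X, hX, hX', ?_⟩
  rw [h, Nat.card_eq_fintype_card]
  exact card_lt_finrank_principal hχ

lemma exists_isOfType_of_ne_one [Finite F] {χ : MulChar F ℂ} (hχ : χ (-1) = 1) (hχ1 : χ ≠ 1) :
    ∃ X : FDRep ℂ PSL(2, F), CategoryTheory.Simple X ∧ IsOfType X χ ∧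
      Nat.card (powMonoidHom 2 : Fˣ →* Fˣ).range + 1 ≤ Module.finrank ℂ X := by
  have := Fintype.ofFinite F
  have := finite_sl (F := F)
  have h0 : principal χ ≠ ⊥ := fun h ↦ by
    have := card_lt_finrank_principal hχ
    rw [h, finrank_bot] at this
    omega
  obtain ⟨W, hW, h⟩ := exists_isMinimalInvariant_le (isInvariant_principal χ) h0
  obtain ⟨X, hX, hX', hd⟩ := exists_fdRep_isOfType hχ hW h
  refine ⟨X, hX, hX', ?_⟩
  rw [hd]
  exact card_squares_lt_finrank_of_le_principal hχ1 hW h.invariant h.ne_bot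

lemma exists_isOfType_one [Finite F] :
    ∃ X : FDRep ℂ PSL(2, F), CategoryTheory.Simple X ∧ IsOfType X 1 ∧
      Nat.card F ≤ Module.finrank ℂ X := by
  have := Fintype.ofFinite F
  have := finite_sl (F := F)
  have := Fintype.ofFinite SL(2, F)
  have h1 : (1 : MulChar F ℂ) (-1) = 1 := by
    simpa using MulChar.one_apply_coe (R' := ℂ) (-1 : Fˣ)
  obtain ⟨X, hX, hX', h⟩ := exists_fdRep_isOfType (W := steinberg F) h1 (fun h hh ↦ hh.1)
    isMinimalInvariant_steinberg
  refine ⟨X, hX, hX', ?_⟩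
  rw [h, Nat.card_eq_fintype_card]
  exact card_le_finrank_steinberg

lemma IsOfType.hasFixedVector {X : FDRep ℂ PSL(2, F)} {χ : MulChar F ℂ} (h : IsOfType X χ) :
    HasFixedVector X :=
  h.hasHighestWeight.hasFixedVector

lemma IsOfType.not_autEquivalent [Finite F] {p : ℕ} [Fact p.Prime] [CharP F p]
    {V W : FDRep ℂ PSL(2, F)} {χ χ' : MulChar F ℂ} (hχ : IsOfType V χ) (hχ' : IsOfType W χ')
    (hW : CategoryTheory.Simple W) {m : ℕ} (h' : χ' ^ m = 1) (h : χ ^ m ≠ 1) :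
    ¬ AutEquivalent V W := by
  intro h0
  obtain ⟨i, hi | hi⟩ := hχ.exists_pow_eq p hW h0 hχ'
  · exact h (by rw [← hi, ← pow_mul, mul_comm, pow_mul, h', one_pow])
  · refine h (inv_injective ?_)
    rw [← inv_pow, ← hi, ← pow_mul, mul_comm, pow_mul, h', one_pow, inv_one]

lemma exists_mulChar_orderOf_eq [Finite F] :
    ∃ ζ : MulChar F ℂ, orderOf ζ = Nat.card F - 1 ∧ ∀ k, (ζ ^ (2 * k)) (-1) = 1 := by
  have := Fintype.ofFinite F
  have h : Nat.card F - 1 ≠ 0 := by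
    have := Finite.one_lt_card (α := F)
    omega
  obtain ⟨ζ, hζ⟩ := MulChar.exists_mulChar_orderOf F
    (by rw [Nat.card_eq_fintype_card]) (Complex.isPrimitiveRoot_exp _ h)
  refine ⟨ζ, hζ, fun k ↦ ?_⟩
  have h1 : (-1 : F) = ((-1 : Fˣ) : F) := by simp
  rw [h1, MulChar.pow_apply_coe, pow_mul, ← map_pow]
  simp

lemma hasNonEquivalentTriple_of_not_dvd [Finite F] {p : ℕ} [Fact p.Prime] [CharP F p]
    (hF : ¬ Nat.card F - 1 ∣ 4) : HasNonEquivalentTriple F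
      (Nat.card (powMonoidHom 2 : Fˣ →* Fˣ).range * (Nat.card F + 1) * Nat.card F) := by
  obtain ⟨ζ, hζ, hneg⟩ := exists_mulChar_orderOf_eq (F := F)
  have h4 : (ζ ^ 2) ^ 2 ≠ 1 := by rwa [← pow_mul, Ne, ← orderOf_dvd_iff_pow_eq_one, hζ]
  obtain ⟨V₁, hV₁, hf, hd₁⟩ := exists_cuspidal_fdRep (F := F)
  obtain ⟨V₂, hV₂, ht₂, hd₂⟩ := exists_isOfType_principal (hneg 1) h4
  obtain ⟨V₃, hV₃, ht₃, hd₃⟩ := exists_isOfType_one (F := F)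
  exact ⟨V₁, V₂, V₃, hV₁, hV₂, hV₃, fun h ↦ hf (ht₂.hasFixedVector.of_autEquivalent p hV₂ h),
    fun h ↦ hf (ht₃.hasFixedVector.of_autEquivalent p hV₃ h),
    ht₂.not_autEquivalent (p := p) ht₃ hV₃ (pow_one 1)
      fun h ↦ h4 (by rw [mul_one, pow_one] at h; rw [h, one_pow]), by gcongr⟩

lemma hasNonEquivalentTriple_of_card_eq_five [Finite F] [CharP F 5] (hF : Nat.card F = 5) :
    HasNonEquivalentTriple F 60 := by
  have : Fact (Nat.Prime 5) := ⟨by norm_num⟩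
  obtain ⟨ζ, hζ, hneg⟩ := exists_mulChar_orderOf_eq (F := F)
  have h2 : ζ ^ (2 * 1) ≠ 1 := by
    rw [Ne, ← orderOf_dvd_iff_pow_eq_one, hζ, hF]; norm_num
  obtain ⟨V₁, hV₁, hf, hd₁⟩ := exists_cuspidal_fdRep (F := F)
  obtain ⟨V₂, hV₂, ht₂, hd₂⟩ := exists_isOfType_of_ne_one (hneg 1) h2
  obtain ⟨V₃, hV₃, ht₃, hd₃⟩ := exists_isOfType_one (F := F)
  have hs := card_le_two_mul_card_squares (F := F)
  rw [hF] at hs hd₃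
  have h4 := Nat.le_of_dvd (by omega) (four_dvd_finrank (CharP.cast_eq_zero F 5) hf)
  refine ⟨V₁, V₂, V₃, hV₁, hV₂, hV₃, fun h ↦ hf (ht₂.hasFixedVector.of_autEquivalent 5 hV₂ h),
    fun h ↦ hf (ht₃.hasFixedVector.of_autEquivalent 5 hV₃ h),
    ht₂.not_autEquivalent (p := 5) ht₃ hV₃ (pow_one 1) (by rwa [pow_one]), ?_⟩
  exact Nat.mul_le_mul (Nat.mul_le_mul h4 (by omega : 3 ≤ _)) hd₃

lemma hasNonEquivalentTriple_of_card_eq_nine [Finite F] [CharP F 3] (hF : Nat.card F = 9) :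
    HasNonEquivalentTriple F 450 := by
  obtain ⟨ζ, hζ, hneg⟩ := exists_mulChar_orderOf_eq (F := F)
  have h1 (k : ℕ) (hk : ¬ 8 ∣ k) : ζ ^ k ≠ 1 := by
    rwa [Ne, ← orderOf_dvd_iff_pow_eq_one, hζ, hF]
  have h8 : ζ ^ 8 = 1 := by rw [← orderOf_dvd_iff_pow_eq_one, hζ, hF]
  obtain ⟨V₁, hV₁, ht₁, hd₁⟩ := exists_isOfType_principal (hneg 1)
    (by rw [← pow_mul]; exact h1 _ (by norm_num))
  obtain ⟨V₂, hV₂, ht₂, hd₂⟩ := exists_isOfType_of_ne_one (hneg 2) (h1 _ (by norm_num))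
  obtain ⟨V₃, hV₃, ht₃, hd₃⟩ := exists_isOfType_one (F := F)
  have hs := card_le_two_mul_card_squares (F := F)
  rw [hF] at hs hd₁ hd₃
  refine ⟨V₁, V₂, V₃, hV₁, hV₂, hV₃,
    ht₁.not_autEquivalent (p := 3) ht₂ hV₂ (m := 2) (by rw [← pow_mul]; exact h8)
      (by rw [← pow_mul]; exact h1 _ (by norm_num)),
    ht₁.not_autEquivalent (p := 3) ht₃ hV₃ (pow_one 1) (by rw [pow_one]; exact h1 _ (by norm_num)),
    ht₂.not_autEquivalent (p := 3) ht₃ hV₃ (pow_one 1) (by rw [pow_one]; exact h1 _ (by norm_num)),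
    ?_⟩
  exact Nat.mul_le_mul (Nat.mul_le_mul hd₁ (by omega : 5 ≤ _)) hd₃

lemma hasNonEquivalentTriple_of_card_eq_sixteen [Finite F] [CharP F 2] (hF : Nat.card F = 16) :
    HasNonEquivalentTriple F (17 * 17 * 16) := by
  obtain ⟨ζ, hζ, hneg⟩ := exists_mulChar_orderOf_eq (F := F)
  have h1 (k : ℕ) (hk : ¬ 15 ∣ k) : ζ ^ k ≠ 1 := by
    rwa [Ne, ← orderOf_dvd_iff_pow_eq_one, hζ, hF]
  have h30 : ζ ^ 30 = 1 := by
    rw [← orderOf_dvd_iff_pow_eq_one, hζ, hF]; norm_num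
  obtain ⟨V₁, hV₁, ht₁, hd₁⟩ := exists_isOfType_principal (hneg 1)
    (by rw [← pow_mul]; exact h1 _ (by norm_num))
  obtain ⟨V₂, hV₂, ht₂, hd₂⟩ := exists_isOfType_principal (hneg 3)
    (by rw [← pow_mul]; exact h1 _ (by norm_num))
  obtain ⟨V₃, hV₃, ht₃, hd₃⟩ := exists_isOfType_one (F := F)
  rw [hF] at hd₁ hd₂ hd₃
  exact ⟨V₁, V₂, V₃, hV₁, hV₂, hV₃,
    ht₁.not_autEquivalent (p := 2) ht₂ hV₂ (m := 5) (by rw [← pow_mul]; exact h30)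
      (by rw [← pow_mul]; exact h1 _ (by norm_num)),
    ht₁.not_autEquivalent (p := 2) ht₃ hV₃ (pow_one 1) (by rw [pow_one]; exact h1 _ (by norm_num)),
    ht₂.not_autEquivalent (p := 2) ht₃ hV₃ (pow_one 1) (by rw [pow_one]; exact h1 _ (by norm_num)),
    Nat.mul_le_mul (Nat.mul_le_mul hd₁ hd₂) hd₃⟩

lemma hasNonEquivalentTriple_of_card_eq_twentySeven [Finite F] [CharP F 3]
    (hF : Nat.card F = 27) : HasNonEquivalentTriple F (28 * 28 * 27) := by
  obtain ⟨ζ, hζ, hneg⟩ := exists_mulChar_orderOf_eq (F := F)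
  have h1 (k : ℕ) (hk : ¬ 26 ∣ k) : ζ ^ k ≠ 1 := by
    rwa [Ne, ← orderOf_dvd_iff_pow_eq_one, hζ, hF]
  obtain ⟨V₁, hV₁, ht₁, hd₁⟩ := exists_isOfType_principal (hneg 1)
    (by rw [← pow_mul]; exact h1 _ (by norm_num))
  obtain ⟨V₂, hV₂, ht₂, hd₂⟩ := exists_isOfType_principal (hneg 2)
    (by rw [← pow_mul]; exact h1 _ (by norm_num))
  obtain ⟨V₃, hV₃, ht₃, hd₃⟩ := exists_isOfType_one (F := F)
  rw [hF] at hd₁ hd₂ hd₃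
  refine ⟨V₁, V₂, V₃, hV₁, hV₂, hV₃, fun h ↦ ?_,
    ht₁.not_autEquivalent (p := 3) ht₃ hV₃ (pow_one 1) (by rw [pow_one]; exact h1 _ (by norm_num)),
    ht₂.not_autEquivalent (p := 3) ht₃ hV₃ (pow_one 1) (by rw [pow_one]; exact h1 _ (by norm_num)),
    Nat.mul_le_mul (Nat.mul_le_mul hd₁ hd₂) hd₃⟩
  have key (i : ℕ) : 3 ^ i % 26 = 1 ∨ 3 ^ i % 26 = 3 ∨ 3 ^ i % 26 = 9 := by
    induction i with
    | zero => simp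
    | succ i ih => rw [pow_succ]; omega
  obtain ⟨i, hi⟩ := ht₁.exists_pow_eq 3 hV₂ h ht₂
  have := key i
  rw [← pow_mul, mul_one] at hi
  rcases hi with hi | hi
  · rw [pow_eq_pow_iff_modEq, hζ, hF, Nat.ModEq] at hi
    omega
  · rw [eq_inv_iff_mul_eq_one, ← pow_add] at hi
    exact h1 _ (by omega) hi

end Triples

section Estimates

lemma le_rpow_logb {S D a b : ℕ} (hb : b ≠ 0) (hθ : 504 ^ a ≤ 168 ^ b) (hD : 1 ≤ D)
    (h : S ^ b ≤ D ^ a) : (S : ℝ) ≤ (D : ℝ) ^ Real.logb 504 168 := by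
  have hb' : (0 : ℝ) < b := by exact_mod_cast Nat.pos_of_ne_zero hb
  have h1 : (a : ℝ) / b ≤ Real.logb 504 168 := by
    rw [div_le_iff₀ hb', mul_comm, ← Real.logb_pow, Real.le_logb_iff_rpow_le (by norm_num)
      (by positivity), Real.rpow_natCast]
    exact_mod_cast hθ
  have h2 : (S : ℝ) ≤ (D : ℝ) ^ ((a : ℝ) / b) := by
    refine le_of_pow_le_pow_left₀ hb (by positivity) ?_
    rw [← Real.rpow_natCast ((D : ℝ) ^ _), ← Real.rpow_mul (by positivity),
      div_mul_cancel₀ _ hb'.ne', Real.rpow_natCast]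
    exact_mod_cast h
  exact h2.trans (Real.rpow_le_rpow_of_exponent_le (by exact_mod_cast hD) h1)

lemma mul_pow_le_pow {f N D c : ℕ} (hc : 0 < c) (h1 : N ^ 3 ≤ (c * D) ^ 2)
    (h2 : f ^ 22 * c ^ 18 ≤ N ^ 5) : (f * N) ^ 11 ≤ D ^ 9 := by
  refine le_of_pow_le_pow_left₀ two_ne_zero (by positivity) ?_
  refine Nat.le_of_mul_le_mul_left (c := c ^ 18) ?_ (by positivity)
  calc c ^ 18 * ((f * N) ^ 11) ^ 2 = f ^ 22 * c ^ 18 * N ^ 22 := by ring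
    _ ≤ N ^ 5 * N ^ 22 := by gcongr
    _ = (N ^ 3) ^ 9 := by ring
    _ ≤ ((c * D) ^ 2) ^ 9 := by gcongr
    _ = c ^ 18 * (D ^ 9) ^ 2 := by ring

lemma pow_mul_le_two_pow {f : ℕ} (hf : 7 ≤ f) : f ^ 22 * 2 ^ 5 ≤ 2 ^ (10 * f) := by
  induction f, hf using Nat.le_induction with
  | base => norm_num
  | succ f hf ih =>
    have h : 7 ^ 22 * (f + 1) ^ 22 ≤ 8 ^ 22 * f ^ 22 := by
      rw [← mul_pow, ← mul_pow]
      exact Nat.pow_le_pow_left (by omega) 22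
    rw [show 10 * (f + 1) = 10 * f + 10 by ring, pow_add]
    have := Nat.zero_le (f ^ 22)
    linarith

lemma pow_mul_le_three_pow {f : ℕ} (hf : 5 ≤ f) : f ^ 22 * 2 ^ 23 ≤ 3 ^ (10 * f) := by
  induction f, hf using Nat.le_induction with
  | base => norm_num
  | succ f hf ih =>
    have h : 5 ^ 22 * (f + 1) ^ 22 ≤ 6 ^ 22 * f ^ 22 := by
      rw [← mul_pow, ← mul_pow]
      exact Nat.pow_le_pow_left (by omega) 22
    rw [show 10 * (f + 1) = 10 * f + 10 by ring, pow_add]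
    have := Nat.zero_le (f ^ 22)
    linarith

lemma even_estimate {f : ℕ} (hf : 7 ≤ f) :
    (f * (2 ^ f * (2 ^ f - 1))) ^ 11 ≤ ((2 ^ f - 1) * (2 ^ f + 1) * 2 ^ f) ^ 9 := by
  have h2 : 2 ≤ 2 ^ f := (Nat.pow_le_pow_right two_pos (by omega : 1 ≤ f))
  have h := pow_mul_le_two_pow hf
  rw [mul_comm 10, pow_mul] at h
  generalize 2 ^ f = q at *
  obtain ⟨m, rfl⟩ : ∃ m, q = m + 1 := ⟨q - 1, by omega⟩
  rw [Nat.add_sub_cancel]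
  refine mul_pow_le_pow (c := 1) one_pos ?_ ?_
  · calc ((m + 1) * m) ^ 3 = ((m + 1) * m) ^ 2 * ((m + 1) * m) := by ring
      _ ≤ ((m + 1) * m) ^ 2 * (m + 2) ^ 2 := by gcongr; nlinarith
      _ = _ := by ring
  · rw [one_pow, mul_one]
    refine Nat.le_of_mul_le_mul_right (h.trans ?_) (by positivity : 0 < 2 ^ 5)
    rw [← mul_pow, show (m + 1) ^ 10 = ((m + 1) ^ 2) ^ 5 by ring]
    gcongr
    nlinarith

lemma odd_estimate {p f q r : ℕ} (hp : 3 ≤ p) (hp4 : p ≠ 4) (hq : q = p ^ f) (hq7 : 7 ≤ q)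
    (hq9 : q ≠ 9) (hq27 : q ≠ 27) (hr : q - 1 ≤ 2 * r) :
    (f * (q * (q - 1))) ^ 11 ≤ (r * (q + 1) * q) ^ 9 := by
  refine mul_pow_le_pow (c := 2) two_pos ?_ ?_
  · obtain ⟨m, rfl⟩ : ∃ m, q = m + 1 := ⟨q - 1, by omega⟩
    rw [Nat.add_sub_cancel] at *
    calc ((m + 1) * m) ^ 3 = (m * ((m + 1) * m)) * (m * (m + 1) ^ 2) := by ring
      _ ≤ ((2 * r) * ((m + 2) * (m + 2))) * ((2 * r) * (m + 1) ^ 2) := by gcongr <;> omega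
      _ = _ := by ring
  have hN {n : ℕ} (hn : n ≤ q) : (n * (n - 1)) ^ 5 ≤ (q * (q - 1)) ^ 5 := by gcongr
  have hp5 {k : ℕ} (h3 : p ≠ 3) : 5 ^ k ≤ p ^ k := Nat.pow_le_pow_left (by omega) k
  match f with
  | 0 => simp
  | 1 => exact le_trans (by norm_num) (hN hq7)
  | 2 =>
    have h3 : p ≠ 3 := by rintro rfl; omega
    exact le_trans (by norm_num) (hN ((hp5 h3).trans_eq hq.symm))
  | 3 =>
    have h3 : p ≠ 3 := by rintro rfl; omega
    exact le_trans (by norm_num) (hN ((hp5 h3).trans_eq hq.symm))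
  | 4 => exact le_trans (by norm_num) (hN ((Nat.pow_le_pow_left hp 4).trans_eq hq.symm))
  | f + 5 =>
    have h := pow_mul_le_three_pow (Nat.le_add_left 5 f)
    have h3 : 3 ^ (10 * (f + 5)) ≤ q ^ 10 := by
      rw [mul_comm 10, pow_mul, hq]
      gcongr
    refine Nat.le_of_mul_le_mul_right (c := 2 ^ 5) ?_ (by positivity)
    rw [mul_assoc, ← pow_add, ← mul_pow]
    refine (h.trans h3).trans ?_
    rw [show q ^ 10 = (q * q) ^ 5 by ring, mul_assoc]
    gcongr
    omega

end Estimates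

section Main

lemma eq_and_eq_of_pow_eq_pow {p r f k : ℕ} (hp : p.Prime) (hr : r.Prime) (hf : f ≠ 0)
    (h : p ^ f = r ^ k) : p = r ∧ f = k := by
  obtain rfl := Nat.prime_eq_prime_of_dvd_pow hp hr (h ▸ dvd_pow_self p hf)
  exact ⟨rfl, Nat.pow_right_injective hp.two_le h⟩

theorem exists_hasNonEquivalentTriple (p f : ℕ) [hp : Fact p.Prime] (hq : 4 ≤ p ^ f) :
    ∃ N : ℕ, HasNonEquivalentTriple (GaloisField p f) N ∧
      (maxSolvableOrder (MulAut PSL(2, GaloisField p f)) : ℝ) ≤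
        (N : ℝ) ^ Real.logb 504 168 := by
  have hf : f ≠ 0 := by rintro rfl; simp at hq
  have hcard : Nat.card (GaloisField p f) = p ^ f := GaloisField.card p f hf
  have hS := maxSolvableOrder_le p f hq
  generalize hS' : maxSolvableOrder (MulAut PSL(2, GaloisField p f)) = S at hS ⊢
  by_cases h5 : p ^ f = 5
  · obtain ⟨rfl, rfl⟩ := eq_and_eq_of_pow_eq_pow (k := 1) hp.out Nat.prime_five hf (by rw [h5]; rfl)
    refine ⟨60, hasNonEquivalentTriple_of_card_eq_five hcard,
      le_rpow_logb (a := 9) (b := 11) (by norm_num) (by norm_num) (by norm_num) ?_⟩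
    exact (Nat.pow_le_pow_left (by omega : S ≤ 24) 11).trans (by norm_num)
  replace hS : S ≤ f * (p ^ f * (p ^ f - 1)) := by
    refine hS.elim id fun ⟨h2, h⟩ ↦ h.trans (Nat.mul_le_mul_left f ?_)
    have h6 : p ^ f ≠ 4 := fun h ↦
      h2 (eq_and_eq_of_pow_eq_pow (k := 2) hp.out Nat.prime_two hf h).1
    have h7 : 6 ≤ p ^ f := by omega
    exact (by norm_num : 24 ≤ 6 * (6 - 1)).trans (by gcongr)
  by_cases h9 : p ^ f = 9
  · obtain ⟨rfl, rfl⟩ := eq_and_eq_of_pow_eq_pow (k := 2) hp.out Nat.prime_three hf h9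
    refine ⟨450, hasNonEquivalentTriple_of_card_eq_nine hcard,
      le_rpow_logb (a := 9) (b := 11) (by norm_num) (by norm_num) (by norm_num) ?_⟩
    exact (Nat.pow_le_pow_left hS 11).trans (by norm_num)
  by_cases h27 : p ^ f = 27
  · obtain ⟨rfl, rfl⟩ := eq_and_eq_of_pow_eq_pow (k := 3) hp.out Nat.prime_three hf h27
    refine ⟨_, hasNonEquivalentTriple_of_card_eq_twentySeven hcard,
      le_rpow_logb (a := 9) (b := 11) (by norm_num) (by norm_num) (by norm_num) ?_⟩
    exact (Nat.pow_le_pow_left hS 11).trans (by norm_num)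
  by_cases h16 : p ^ f = 16
  · obtain ⟨rfl, rfl⟩ := eq_and_eq_of_pow_eq_pow (k := 4) hp.out Nat.prime_two hf h16
    refine ⟨_, hasNonEquivalentTriple_of_card_eq_sixteen hcard,
      le_rpow_logb (a := 9) (b := 11) (by norm_num) (by norm_num) (by norm_num) ?_⟩
    exact (Nat.pow_le_pow_left hS 11).trans (by norm_num)
  have hdvd : ¬ Nat.card (GaloisField p f) - 1 ∣ 4 := by
    rw [hcard]
    intro h
    have := Nat.le_of_dvd (by norm_num) h
    have h4 : p ^ f = 4 := by omega
    rw [h4] at h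
    norm_num at h
  refine ⟨_, hasNonEquivalentTriple_of_not_dvd (p := p) hdvd, ?_⟩
  rcases eq_or_ne p 2 with rfl | hp2
  · rw [card_squares_of_two_eq_zero (CharP.cast_eq_zero (GaloisField 2 f) 2), hcard]
    rcases le_or_gt 7 f with h7 | h7
    · have h8 : 2 ≤ 2 ^ f := (by norm_num : 2 ≤ 4).trans hq
      exact le_rpow_logb (a := 9) (b := 11) (by norm_num) (by norm_num)
        (Nat.mul_pos (Nat.mul_pos (by omega) (by omega)) (by omega))
        ((Nat.pow_le_pow_left hS 11).trans (even_estimate h7))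
    · interval_cases f
      · exact absurd rfl hf
      · norm_num at hq
      · exact le_rpow_logb (a := 9) (b := 11) (by norm_num) (by norm_num) (by norm_num)
          ((Nat.pow_le_pow_left hS 11).trans (by norm_num))
      · refine (Nat.cast_le.2 hS).trans_eq ?_
        have := Real.rpow_logb (b := 504) (x := 168) (by norm_num) (by norm_num) (by norm_num)
        norm_num [this]
      · norm_num at h16
      · exact le_rpow_logb (a := 23) (b := 28) (by norm_num) (by norm_num) (by norm_num)
          ((Nat.pow_le_pow_left hS 28).trans (by norm_num))
      · exact le_rpow_logb (a := 9) (b := 11) (by norm_num) (by norm_num) (by norm_num)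
          ((Nat.pow_le_pow_left hS 11).trans (by norm_num))
  · have hp3 : 3 ≤ p := by have := hp.out.two_le; omega
    have hp4 : p ≠ 4 := fun h ↦ by have := hp.out; rw [h] at this; norm_num at this
    have hr := card_le_two_mul_card_squares (F := GaloisField p f)
    have h4 : p ^ f ≠ 4 := fun h ↦
      hp2 (eq_and_eq_of_pow_eq_pow (k := 2) hp.out Nat.prime_two hf h).1
    have h6 : p ^ f ≠ 6 := fun h ↦ by
      have := (hp.out.odd_of_ne_two hp2).pow (n := f)
      rw [h] at this
      exact absurd this (by decide)
    rw [hcard] at hr ⊢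
    exact le_rpow_logb (a := 9) (b := 11) (by norm_num) (by norm_num)
      (Nat.mul_pos (Nat.mul_pos (by omega) (by omega)) (by omega))
      ((Nat.pow_le_pow_left hS 11).trans
        (odd_estimate hp3 hp4 rfl (by omega) h9 h27 hr))

end Main

end PSLTwo

/-- For `G = PSL₂(q)`, `q ≥ 4` a prime power, there are three pairwise non-Aut-equivalent
irreducible characters `χ₁, χ₂, χ₃` of `G` with
`S(Aut G) ≤ (χ₁(1)·χ₂(1)·χ₃(1)) ^ (μ/3)`, where `μ = 3·log_{504} 168`. -/
theorem psl_two_three_non_aut_equivalent_chars (p f : ℕ) [Fact p.Prime]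
    (hq : 4 ≤ p ^ f) :
    ∃ V₁ V₂ V₃ : FDRep ℂ (Matrix.ProjectiveSpecialLinearGroup (Fin 2) (GaloisField p f)),
      CategoryTheory.Simple V₁ ∧ CategoryTheory.Simple V₂ ∧ CategoryTheory.Simple V₃ ∧
      ¬ AutEquivalent V₁ V₂ ∧ ¬ AutEquivalent V₁ V₃ ∧ ¬ AutEquivalent V₂ V₃ ∧
      (maxSolvableOrder
          (MulAut (Matrix.ProjectiveSpecialLinearGroup (Fin 2) (GaloisField p f))) : ℝ) ≤
        ((Module.finrank ℂ V₁ * Module.finrank ℂ V₂ * Module.finrank ℂ V₃ : ℕ) : ℝ) ^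
          ((3 * Real.logb 504 168) / 3) := by
  obtain ⟨N, ⟨V₁, V₂, V₃, h₁, h₂, h₃, h₁₂, h₁₃, h₂₃, hN⟩, hS⟩ :=
    PSLTwo.exists_hasNonEquivalentTriple p f hq
  refine ⟨V₁, V₂, V₃, h₁, h₂, h₃, h₁₂, h₁₃, h₂₃, hS.trans ?_⟩
  rw [mul_div_cancel_left₀ _ three_ne_zero]
  exact Real.rpow_le_rpow (by positivity) (by exact_mod_cast hN)
    (Real.logb_nonneg (by norm_num) (by norm_num))
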